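/- arXiv:math/0403277 — 8 statements merged into one kernel-verified Lean document; each statement's English description precedes it below -/
import Mathlib

section
/- Let N, μ, m be positive integers with 2μ ≥ N, μ < N, and gcd(m, μ+1) < (μ+1)/(N−μ). Let λ = (m^{N−μ}) be the partition with N−μ parts equal to m, and let λ' = λ − ε(N−μ) = (m^{N−μ−1}, m−1) be obtained by subtracting 1 from the last part. Then the four hook-length products h(λ,1), h(λ,κ+1), h(λ',1), h(λ',κ+1), evaluated at κ = −m/(μ+1), are all nonzero. -/
open Finset

/-- Hook-length factor at the node in (0-based) row `i`, (0-based) column `j` of the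
Ferrers diagram of the partition with parts `lam 0, lam 1, …, lam (len-1)`:
`λ_i - j + t + κ·#{l : l > i and j ≤ λ_l}` (in 1-based coordinates). -/
def hookFactor (len : ℕ) (lam : ℕ → ℕ) (t κ : ℚ) (i j : ℕ) : ℚ :=
  (lam i : ℚ) - ((j : ℚ) + 1) + t +
    κ * ((((Finset.range len).filter fun l => i < l ∧ j + 1 ≤ lam l).card : ℚ))

/-- Hook-length product `h(λ, t) = ∏_{i=1}^{len} ∏_{j=1}^{λ_i} h(λ,t;i,j)`. -/
def hookProd (len : ℕ) (lam : ℕ → ℕ) (t κ : ℚ) : ℚ :=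
  ∏ i ∈ Finset.range len, ∏ j ∈ Finset.range (lam i), hookFactor len lam t κ i j

/-- If `b * gcd m q < q`, then `m * b` is divisible by `q` only for `b = 0`; hence it is never a
positive multiple of `q`. -/
theorem mul_ne_mul_of_mul_gcd_lt {m q a b : ℕ} (ha : 0 < a) (h : b * Nat.gcd m q < q) :
    a * q ≠ m * b := by
  intro heq
  have hdvd : q ∣ b * Nat.gcd m q := by
    rw [← Nat.gcd_mul_left]
    exact Nat.dvd_gcd ⟨a, by linarith⟩ (Nat.dvd_mul_left q b)
  have hzero : b * Nat.gcd m q = 0 := Nat.eq_zero_of_dvd_of_lt hdvd h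
  have hq : 0 < q := by omega
  have hb : b = 0 := by
    rcases Nat.mul_eq_zero.mp hzero with hb | hg
    · exact hb
    · exact absurd hg (Nat.gcd_pos_of_pos_right m hq).ne'
  have hpos : 0 < a * q := Nat.mul_pos ha hq
  simp [heq, hb] at hpos

theorem natCast_add_neg_div_mul_ne_zero {m q a b : ℕ} (ha : 0 < a) (h : b * Nat.gcd m q < q) :
    (a : ℚ) + -(m : ℚ) / q * b ≠ 0 := by
  intro heq
  have hq : (q : ℚ) ≠ 0 := by
    have : q ≠ 0 := by omega
    exact_mod_cast this
  field_simp at heq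
  apply mul_ne_mul_of_mul_gcd_lt ha h
  have hcast : (a : ℚ) * q = m * b := by linarith
  exact_mod_cast hcast

/-- The leg length of a node is less than the number of parts. -/
theorem card_leg_lt {len i : ℕ} (lam : ℕ → ℕ) (j : ℕ) (hi : i < len) :
    ((Finset.range len).filter fun l => i < l ∧ j + 1 ≤ lam l).card < len := by
  conv_rhs => rw [← Finset.card_range len]
  apply Finset.card_lt_card
  rw [Finset.filter_ssubset]
  exact ⟨i, Finset.mem_range.mpr hi, by simp⟩

/-- Both hook products of any partition with `len` parts are nonzero at `κ = -m/q` as soon as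
`len * gcd m q < q`. -/
theorem hookProd_ne_zero {len m q : ℕ} (lam : ℕ → ℕ) (h : len * Nat.gcd m q < q) :
    hookProd len lam 1 (-(m : ℚ) / q) ≠ 0 ∧
      hookProd len lam (-(m : ℚ) / q + 1) (-(m : ℚ) / q) ≠ 0 := by
  have key : ∀ {i j b : ℕ}, j < lam i → b ≤ len →
      ((lam i - j : ℕ) : ℚ) + -(m : ℚ) / q * b ≠ 0 := fun hj hb =>
    natCast_add_neg_div_mul_ne_zero (Nat.sub_pos_of_lt hj)
      ((Nat.mul_le_mul_right _ hb).trans_lt h)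
  constructor <;> refine Finset.prod_ne_zero_iff.mpr fun i hi =>
    Finset.prod_ne_zero_iff.mpr fun j hj => ?_
  all_goals
    rw [Finset.mem_range] at hi hj
    have hleg := card_leg_lt lam j hi
  · convert key hj hleg.le using 1
    rw [hookFactor, Nat.cast_sub hj.le]
    ring
  · convert key hj (Nat.succ_le_of_lt hleg) using 1
    rw [hookFactor, Nat.cast_sub hj.le]
    push_cast
    ring

/-- For `2μ ≥ N`, `μ < N`, `gcd(m, μ+1) < (μ+1)/(N-μ)`, with
`λ = (m^{N-μ})` and `λ' = λ - ε(N-μ)`, the four hook products `h(λ,1)`,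
`h(λ,κ+1)`, `h(λ',1)`, `h(λ',κ+1)` are nonzero at `κ = -m/(μ+1)`. -/
theorem hook_products_nonzero_two_part (N μ m : ℕ)
    (hN : 0 < N) (hμ : 0 < μ) (hm : 0 < m)
    (h2μ : N ≤ 2 * μ) (hμN : μ < N)
    (hgcd : ((Nat.gcd m (μ + 1) : ℚ)) < ((μ : ℚ) + 1) / ((N : ℚ) - (μ : ℚ)))
    (κ₀ : ℚ) (hκ : κ₀ = -(m : ℚ) / (μ + 1)) :
    hookProd (N - μ) (fun _ => m) 1 κ₀ ≠ 0 ∧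
    hookProd (N - μ) (fun _ => m) (κ₀ + 1) κ₀ ≠ 0 ∧
    hookProd (N - μ) (fun i => if i = N - μ - 1 then m - 1 else m) 1 κ₀ ≠ 0 ∧
    hookProd (N - μ) (fun i => if i = N - μ - 1 then m - 1 else m) (κ₀ + 1) κ₀ ≠ 0 := by
  have hgcd' : (N - μ) * Nat.gcd m (μ + 1) < μ + 1 := by
    have hpos : (0 : ℚ) < (N : ℚ) - μ := sub_pos.mpr (by exact_mod_cast hμN)
    rw [lt_div_iff₀ hpos, ← Nat.cast_sub hμN.le, mul_comm] at hgcd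
    exact_mod_cast hgcd
  have hκ' : κ₀ = -(m : ℚ) / ((μ + 1 : ℕ) : ℚ) := by rw [hκ]; push_cast; rfl
  subst hκ'
  obtain ⟨h₁, h₂⟩ := hookProd_ne_zero (fun _ => m) hgcd'
  obtain ⟨h₃, h₄⟩ := hookProd_ne_zero (fun i => if i = N - μ - 1 then m - 1 else m) hgcd'
  exact ⟨h₁, h₂, h₃, h₄⟩
end

section
/- Let λ = Λ(μ,s,l,ρ,m). Then the hook-length products h(λ,1) and h(λ,κ+1), evaluated at κ = −m/(μ+1), are both nonzero. -/
open Finset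

/-- The partition `Λ(μ,s,l,ρ,m)` (0-based indexing of parts): `ρ` parts equal to
`m(s+l+1)` followed by, for `i = l, l-1, …, 1`, `μ` parts equal to `m(s+i)`;
its length is `ρ + lμ`. -/
def LamPart (μ s l ρ m : ℕ) : ℕ → ℕ := fun i =>
  if i < ρ then m * (s + l + 1)
  else if i < ρ + l * μ then m * (s + l - (i - ρ) / μ)
  else 0

/-- Moving down by at least `c * μ` rows in `Λ(μ,s,l,ρ,m)` shortens the row by at least `m * c`. -/
theorem LamPart_add_le {μ s l ρ m i i' c : ℕ} (hμ : 1 ≤ μ) (hρμ : ρ ≤ μ) (hc : 1 ≤ c)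
    (hlen : i' < ρ + l * μ) (hi : i + c * μ ≤ i') :
    LamPart μ s l ρ m i' + m * c ≤ LamPart μ s l ρ m i := by
  have hcμ : μ ≤ c * μ := Nat.le_mul_of_pos_left μ hc
  have hq : (i' - ρ) / μ < l := by
    rw [Nat.div_lt_iff_lt_mul (by omega)]
    omega
  have hi' : ¬ i' < ρ := by omega
  unfold LamPart
  rw [if_neg hi', if_pos hlen]
  split_ifs with h1 h2
  · have hc' : c ≤ (i' - ρ) / μ + 1 := by
      rw [← Nat.add_div_right _ (by omega), Nat.le_div_iff_mul_le (by omega)]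
      omega
    rw [← mul_add]
    exact Nat.mul_le_mul_left m (by omega)
  · have hc' : (i - ρ) / μ + c ≤ (i' - ρ) / μ := by
      rw [← Nat.add_mul_div_right _ _ (by omega)]
      exact Nat.div_le_div_right (by omega)
    rw [← mul_add]
    exact Nat.mul_le_mul_left m (by omega)
  · omega

/-- The leg length of a node of `Λ(μ,s,l,ρ,m)` whose arm length is `m * c - 1` is
less than `c * μ`. -/
theorem card_leg_LamPart_lt {μ s l ρ m i j c : ℕ} (hμ : 1 ≤ μ) (hρμ : ρ ≤ μ) (hc : 1 ≤ c)
    (hj : j + m * c = LamPart μ s l ρ m i) :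
    ((range (ρ + l * μ)).filter fun k => i < k ∧ j + 1 ≤ LamPart μ s l ρ m k).card < c * μ := by
  have hpos : 0 < c * μ := Nat.mul_pos hc hμ
  have hsub : ((range (ρ + l * μ)).filter fun k => i < k ∧ j + 1 ≤ LamPart μ s l ρ m k) ⊆
      Ioo i (i + c * μ) := by
    intro k hk
    simp only [mem_filter, mem_range, mem_Ioo] at hk ⊢
    refine ⟨hk.2.1, ?_⟩
    by_contra! h
    have := LamPart_add_le (s := s) (m := m) hμ hρμ hc hk.1 h
    omega
  have hcard := card_le_card hsub
  rw [Nat.card_Ioo] at hcard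
  omega

/-- The balance `(μ + 1) * (arm + 1) = m * b` fails for `b` equal to the leg length
or to the leg length plus one. -/
theorem arm_leg_LamPart_ne {μ s l ρ m i j b : ℕ} (hμ : 1 ≤ μ) (hρμ : ρ ≤ μ)
    (hgcd : Nat.gcd m (μ + 1) = 1) (hj : j < LamPart μ s l ρ m i)
    (hb : b ≤ ((range (ρ + l * μ)).filter
      fun k => i < k ∧ j + 1 ≤ LamPart μ s l ρ m k).card + 1) :
    (μ + 1) * (LamPart μ s l ρ m i - j) ≠ m * b := by
  intro h
  obtain ⟨c, rfl⟩ : μ + 1 ∣ b :=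
    (Nat.Coprime.symm hgcd).dvd_of_dvd_mul_left (Dvd.intro _ h)
  have harm : LamPart μ s l ρ m i - j = m * c := by
    apply Nat.eq_of_mul_eq_mul_left (Nat.succ_pos μ)
    rw [Nat.succ_eq_add_one, h]
    ring
  have hc : 1 ≤ c := by
    rcases Nat.eq_zero_or_pos c with rfl | hc
    · omega
    · exact hc
  have hleg := card_leg_LamPart_lt (s := s) (l := l) (m := m) (i := i) (j := j) hμ hρμ hc (by omega)
  have : (μ + 1) * c = c * μ + c := by ring
  omega

/-- If `κ = -m/(μ+1)` and `t = 1 + ε κ` with `ε ≤ 1`, then `h(Λ(μ,s,l,ρ,m), t)` is nonzero. -/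
theorem hookProd_LamPart_ne_zero {μ s l ρ m ε : ℕ} (hμ : 1 ≤ μ) (hρμ : ρ ≤ μ)
    (hgcd : Nat.gcd m (μ + 1) = 1) (hε : ε ≤ 1) {κ t : ℚ} (hκ : κ = -(m : ℚ) / (μ + 1))
    (ht : t = 1 + ε * κ) :
    hookProd (ρ + l * μ) (LamPart μ s l ρ m) t κ ≠ 0 := by
  refine prod_ne_zero_iff.mpr fun i _ => prod_ne_zero_iff.mpr fun j hj h => ?_
  have hj := mem_range.mp hj
  unfold hookFactor at h
  refine arm_leg_LamPart_ne hμ hρμ hgcd hj (Nat.add_le_add_left hε _) ?_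
  have hμ' : (μ : ℚ) + 1 ≠ 0 := by positivity
  have hκ' : κ * (μ + 1) = -m := by rw [hκ, div_mul_cancel₀ _ hμ']
  rw [← Nat.cast_inj (R := ℚ)]
  push_cast [Nat.cast_sub hj.le]
  rw [ht] at h
  linear_combination ((μ : ℚ) + 1) * h - (ε + (((range (ρ + l * μ)).filter
    fun k => i < k ∧ j + 1 ≤ LamPart μ s l ρ m k).card : ℚ)) * hκ'

/-- For `λ = Λ(μ,s,l,ρ,m)`, the hook products `h(λ,1)` and `h(λ,κ+1)`
are nonzero at `κ = -m/(μ+1)`. -/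
theorem hook_products_nonzero_Lambda (μ s l ρ m : ℕ)
    (hμ : 1 ≤ μ) (hl : 1 ≤ l) (hρ1 : 1 ≤ ρ) (hρμ : ρ ≤ μ) (hm : 1 ≤ m)
    (hgcd : Nat.gcd m (μ + 1) = 1)
    (κ₀ : ℚ) (hκ : κ₀ = -(m : ℚ) / (μ + 1)) :
    hookProd (ρ + l * μ) (LamPart μ s l ρ m) 1 κ₀ ≠ 0 ∧
    hookProd (ρ + l * μ) (LamPart μ s l ρ m) (κ₀ + 1) κ₀ ≠ 0 := by
  exact ⟨hookProd_LamPart_ne_zero (ε := 0) hμ hρμ hgcd zero_le_one hκ (by simp),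
    hookProd_LamPart_ne_zero (ε := 1) hμ hρμ hgcd le_rfl hκ (by simp [add_comm])⟩
end

section
/- Let λ = Λ(μ,s,l,ρ,m), κ₀ = −m/(μ+1), and set i_0 = 0 and i_j = ρ + (j−1)μ for 1 ≤ j ≤ l+1 (the points of decrease of λ), so that the part of λ at position i_j is m(s+2+l−j) for 1 ≤ j ≤ l+1. Then all the denominators of the coefficients C'_{kj} are nonzero at κ = κ₀: explicitly, (i_j − i_{j−1} − 1)κ₀ + 1 ≠ 0 for every 1 ≤ j ≤ l+1, and (i_j − i_k − 1)κ₀ + λ_{i_{k+1}} − λ_{i_j} + 1 ≠ 0 for every 0 ≤ k < j−1 ≤ l. -/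
open Finset

/-- The partition `Λ(μ,s,l,ρ,m)` as a 1-based function, padded with zeros. -/
def Lam1 (μ s l ρ m : ℕ) : ℕ → ℕ := fun i =>
  if i = 0 then 0
  else if i ≤ ρ then m * (s + l + 1)
  else if i ≤ ρ + l * μ then m * (s + l - (i - ρ - 1) / μ)
  else 0

/-- The points of decrease of `Λ(μ,s,l,ρ,m)`: `i_0 = 0` and `i_j = ρ + (j-1)μ`
for `1 ≤ j ≤ l+1`. -/
def iIdx (ρ μ : ℕ) (j : ℕ) : ℕ := if j = 0 then 0 else ρ + (j - 1) * μ

theorem Lam1_iIdx {μ s l ρ m j : ℕ} (hμ : 1 ≤ μ) (hρ : 1 ≤ ρ) (hj : j ≤ l) :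
    Lam1 μ s l ρ m (iIdx ρ μ (j + 1)) = m * (s + l + 1 - j) := by
  rcases j with _ | j
  · simp [Lam1, iIdx, Nat.ne_of_gt hρ]
  · have hpos : 0 < (j + 1) * μ := by positivity
    have hle : (j + 1) * μ ≤ l * μ := Nat.mul_le_mul_right μ hj
    have hdiv : (ρ + (j + 1) * μ - ρ - 1) / μ = j := by
      rw [Nat.add_sub_cancel_left]
      refine Nat.div_eq_of_lt_le ?_ ?_
      · rw [Nat.add_mul]; omega
      · omega
    have hidx : iIdx ρ μ (j + 1 + 1) = ρ + (j + 1) * μ := by simp [iIdx]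
    rw [hidx, Lam1, if_neg (by omega), if_neg (by omega), if_pos (by omega), hdiv]
    congr 1
    omega

theorem iIdx_sub_iIdx_sub_one_lt {ρ μ k j : ℕ} (hμ : 1 ≤ μ) (hρμ : ρ ≤ μ) (hkj : k < j) :
    iIdx ρ μ j - iIdx ρ μ k - 1 < (j - k) * μ := by
  obtain ⟨d, rfl⟩ := Nat.exists_eq_add_of_lt hkj
  have hpos : 0 < (d + 1) * μ := by positivity
  have hsub : k + d + 1 - k = d + 1 := by omega
  rw [hsub]
  rcases k with _ | k
  · simp only [iIdx, Nat.add_mul] at *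
    simp
    omega
  · simp only [iIdx, Nat.add_mul, Nat.add_sub_cancel] at *
    simp only [Nat.add_eq_zero_iff, one_ne_zero, and_false, if_false]
    omega

theorem mul_neg_div_add_mul_add_one_ne_zero {μ m a c : ℕ} (hgcd : Nat.Coprime m (μ + 1))
    (ha : a < (c + 1) * μ) :
    (a : ℚ) * (-(m : ℚ) / (μ + 1)) + m * c + 1 ≠ 0 := by
  intro h
  have hne : (μ : ℚ) + 1 ≠ 0 := by positivity
  field_simp at h
  have hnat : m * a = (m * c + 1) * (μ + 1) := by
    have : (m : ℚ) * a = (m * c + 1) * (μ + 1) := by linarith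
    exact_mod_cast this
  have hcop : Nat.Coprime m ((m * c + 1) * (μ + 1)) :=
    Nat.Coprime.mul_right (by simp) hgcd
  have hm : m = 1 := Nat.Coprime.eq_one_of_dvd hcop ⟨a, hnat.symm⟩
  subst hm
  nlinarith

/-- for `λ = Λ(μ,s,l,ρ,m)` and `κ₀ = -m/(μ+1)`, the denominators of the
coefficients `C'_{kj}` are nonzero at `κ₀`: `(i_j - i_{j-1} - 1)κ₀ + 1 ≠ 0` for
`1 ≤ j ≤ l+1`, and `(i_j - i_k - 1)κ₀ + λ_{i_{k+1}} - λ_{i_j} + 1 ≠ 0` for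
`0 ≤ k < j-1 ≤ l`. -/
theorem Cprime_denominators_nonzero (μ s l ρ m : ℕ)
    (hμ : 1 ≤ μ) (hl : 1 ≤ l) (hρ1 : 1 ≤ ρ) (hρμ : ρ ≤ μ) (hm : 1 ≤ m)
    (hgcd : Nat.gcd m (μ + 1) = 1)
    (κ₀ : ℚ) (hκ : κ₀ = -(m : ℚ) / (μ + 1)) :
    (∀ j : ℕ, 1 ≤ j → j ≤ l + 1 →
      ((iIdx ρ μ j - iIdx ρ μ (j - 1) - 1 : ℕ) : ℚ) * κ₀ + 1 ≠ 0) ∧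
    (∀ k j : ℕ, k < j - 1 → j ≤ l + 1 →
      ((iIdx ρ μ j - iIdx ρ μ k - 1 : ℕ) : ℚ) * κ₀ +
        ((Lam1 μ s l ρ m (iIdx ρ μ (k + 1)) : ℚ) - (Lam1 μ s l ρ m (iIdx ρ μ j) : ℚ)) + 1 ≠ 0) := by
  subst hκ
  refine ⟨fun j hj _ => ?_, fun k j hkj hj => ?_⟩
  · have hlt := iIdx_sub_iIdx_sub_one_lt hμ hρμ (show j - 1 < j by omega)
    rw [show j - (j - 1) = 0 + 1 by omega] at hlt
    simpa using mul_neg_div_add_mul_add_one_ne_zero hgcd hlt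
  · have hlt := iIdx_sub_iIdx_sub_one_lt hμ hρμ (show k < j by omega)
    obtain ⟨c, rfl⟩ : ∃ c, j = k + c + 1 := ⟨j - k - 1, by omega⟩
    rw [show k + c + 1 - k = c + 1 by omega] at hlt
    have key := mul_neg_div_add_mul_add_one_ne_zero hgcd hlt
    rw [Lam1_iIdx hμ hρ1 (show k ≤ l by omega), Lam1_iIdx hμ hρ1 (show k + c ≤ l by omega)]
    have hdiff : ((m * (s + l + 1 - k) : ℕ) : ℚ) - ((m * (s + l + 1 - (k + c)) : ℕ) : ℚ)
        = m * c := by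
      rw [show s + l + 1 - k = s + l + 1 - (k + c) + c by omega]
      push_cast
      ring
    rwa [hdiff]
end

section
/- Assume the standing hypothesis on λ, β (with 0 ≤ k ≤ l−1, L = ρ+lμ, M = L + |λ|). Suppose γ ∈ ℕ₀, let G = {j : 1 ≤ j ≤ L, β_j = mγ}, and assume either m > 1, or m = 1 and ρ+kμ ∉ G. If G has nonempty intersection with at least two of the cells I_0, I_1, …, I_l, then #G ≤ μ−1; if moreover one of the cells met by G is I_0, then #G ≤ ρ−1. -/
open Finset

/-- `λ = Λ(μ,s,l,ρ,m) - ε(ρ+kμ)`: subtract 1 from part number `ρ+kμ` (1-based). -/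
def lamK (μ s l ρ m k : ℕ) : ℕ → ℕ := fun i =>
  if i = ρ + k * μ then Lam1 μ s l ρ m i - 1 else Lam1 μ s l ρ m i

/-- The rank `r(α,i) = #{j : α_j > α_i} + #{j : 1 ≤ j ≤ i, α_j = α_i}` of a
composition `α ∈ ℕ₀^M` (1-based). -/
def rank (M : ℕ) (α : ℕ → ℕ) (i : ℕ) : ℕ :=
  ((Finset.Icc 1 M).filter fun j => α i < α j).card +
  ((Finset.Icc 1 i).filter fun j => α j = α i).card

/-- partial sum `Σ_{i=1}^{j} α_i`. -/
def psum (α : ℕ → ℕ) (j : ℕ) : ℕ := ∑ i ∈ Finset.Icc 1 j, α i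

/-- `ℓ(α) = max{j : α_j > 0}` for a composition in `ℕ₀^M`. -/
def lenOf (M : ℕ) (α : ℕ → ℕ) : ℕ := ((Finset.Icc 1 M).filter fun j => α j ≠ 0).sup id

/-- the decreasing rearrangement `α⁺` of `(α_1, …, α_M)`, as a 1-based function. -/
def decRe (M : ℕ) (α : ℕ → ℕ) : ℕ → ℕ := fun i =>
  (List.insertionSort (· ≥ ·) ((List.range M).map fun j => α (j + 1))).getD (i - 1) 0

/-- `α ⪰ β`: all partial sums of `α` dominate those of `β`. -/
def domsWeak (M : ℕ) (α β : ℕ → ℕ) : Prop :=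
  ∀ j ∈ Finset.Icc 1 M, psum β j ≤ psum α j

/-- `α ≻ β`: `α ≠ β` and all partial sums of `α` dominate those of `β`. -/
def doms (M : ℕ) (α β : ℕ → ℕ) : Prop :=
  (∃ i ∈ Finset.Icc 1 M, α i ≠ β i) ∧ domsWeak M α β

/-- `α ▷ β`: `|α| = |β|` and either `α⁺ ≻ β⁺`, or `α⁺ = β⁺` and `α ≻ β`. -/
def trig (M : ℕ) (α β : ℕ → ℕ) : Prop :=
  psum α M = psum β M ∧
  (doms M (decRe M α) (decRe M β) ∨
    ((∀ i ∈ Finset.Icc 1 M, decRe M α i = decRe M β i) ∧ doms M α β))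

/-- `α ⊵ β`: `α ▷ β` or `α = β`. -/
def trigeq (M : ℕ) (α β : ℕ → ℕ) : Prop :=
  trig M α β ∨ ∀ i ∈ Finset.Icc 1 M, α i = β i

/-- The cells `I_0 = [1,ρ]` and `I_j = [ρ+(j-1)μ+1, ρ+jμ]` for `j ≥ 1`. -/
def cellI (ρ μ : ℕ) (j : ℕ) : Finset ℕ :=
  if j = 0 then Finset.Icc 1 ρ else Finset.Icc (ρ + (j - 1) * μ + 1) (ρ + j * μ)

theorem mem_cellI_iff {ρ μ j i : ℕ} :
    i ∈ cellI ρ μ j ↔ 1 ≤ i ∧ i ≤ ρ + j * μ ∧ (j ≠ 0 → ρ + (j - 1) * μ + 1 ≤ i) := by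
  unfold cellI
  split_ifs with h
  · simp [h]
  · simp only [Finset.mem_Icc]
    constructor
    · rintro ⟨h₁, h₂⟩
      exact ⟨by omega, h₂, fun _ => h₁⟩
    · rintro ⟨-, h₂, h₁⟩
      exact ⟨h₁ h, h₂⟩

theorem exists_mem_cellI {ρ μ l i : ℕ} (hi : 1 ≤ i) (hil : i ≤ ρ + l * μ) :
    ∃ j ≤ l, i ∈ cellI ρ μ j := by
  induction l with
  | zero => exact ⟨0, le_rfl, mem_cellI_iff.2 ⟨hi, hil, fun h => absurd rfl h⟩⟩
  | succ l ih =>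
    by_cases h : i ≤ ρ + l * μ
    · obtain ⟨j, hj, hij⟩ := ih h
      exact ⟨j, by omega, hij⟩
    · exact ⟨l + 1, le_rfl, mem_cellI_iff.2 ⟨hi, hil, fun _ => by simpa using h⟩⟩

/-- The index of the cell is monotone in the position. -/
theorem cellI_index_mono {ρ μ i i' j j' : ℕ} (hi : i ∈ cellI ρ μ j) (hi' : i' ∈ cellI ρ μ j')
    (h : i ≤ i') : j ≤ j' := by
  by_contra! hlt
  have h₁ := (mem_cellI_iff.1 hi).2.2 (by omega)
  have h₂ := (mem_cellI_iff.1 hi').2.1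
  have h₃ : j' * μ ≤ (j - 1) * μ := Nat.mul_le_mul_right _ (by omega)
  omega

theorem Lam1_eq_of_mem_cellI {μ s l ρ m i j : ℕ} (hμ : 1 ≤ μ) (hj : j ≤ l)
    (hi : i ∈ cellI ρ μ j) : Lam1 μ s l ρ m i = m * (s + l + 1 - j) := by
  obtain ⟨h₁, h₂, h₃⟩ := mem_cellI_iff.1 hi
  unfold Lam1
  rw [if_neg (by omega)]
  rcases j with _ | j
  · rw [if_pos (by simpa using h₂)]
    simp
  · have h₃ := h₃ (by omega)
    rw [Nat.add_sub_cancel] at h₃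
    have h₄ : (j + 1) * μ ≤ l * μ := Nat.mul_le_mul_right _ hj
    rw [if_neg (by omega), if_pos (by omega)]
    have hdiv : (i - ρ - 1) / μ = j := by
      rw [Nat.div_eq_iff (by omega)]
      rw [Nat.succ_mul] at h₂
      omega
    rw [hdiv]
    congr 1
    omega

/-- If `a` is the first index of its value and `b` is an index with the same value, then the
ranks of `a` and `b` differ by at least the number of further indices up to `b` with that value. -/
theorem rank_add_card_le {M a b v : ℕ} {α : ℕ → ℕ} {G : Finset ℕ} (ha : α a = v) (hb : α b = v)
    (hmin : ∀ j ∈ Finset.Icc 1 a, α j = v → j = a)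
    (hG : ∀ j ∈ G, 1 ≤ j ∧ j ≤ b ∧ α j = v) :
    rank M α a + G.card ≤ rank M α b + 1 := by
  have h₁ : ((Finset.Icc 1 a).filter fun j => α j = v).card ≤ 1 := by
    refine Finset.card_le_one.2 fun x hx y hy => ?_
    rw [Finset.mem_filter] at hx hy
    rw [hmin x hx.1 hx.2, hmin y hy.1 hy.2]
  have h₂ : G.card ≤ ((Finset.Icc 1 b).filter fun j => α j = v).card := by
    refine Finset.card_le_card fun j hj => ?_
    obtain ⟨hj₁, hj₂, hj₃⟩ := hG j hj
    exact Finset.mem_filter.2 ⟨Finset.mem_Icc.2 ⟨hj₁, hj₂⟩, hj₃⟩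
  unfold rank
  rw [ha, hb]
  omega

/-- The rank equation at a position of `I_j` whose value is `mγ`, divided by `m`. -/
theorem rank_eq_of_mem_cellI {μ s l ρ m k M i j γ : ℕ} {β : ℕ → ℕ} (hμ : 1 ≤ μ) (hm : 1 ≤ m)
    (hj : j ≤ l) (hi : i ∈ cellI ρ μ j) (hik : i ≠ ρ + k * μ) (hβ : β i = m * γ)
    (hrank : (m : ℤ) * ((rank M β i : ℤ) - (i : ℤ)) =
      ((μ : ℤ) + 1) * ((lamK μ s l ρ m k i : ℤ) - (β i : ℤ))) :
    (rank M β i : ℤ) - i = ((μ : ℤ) + 1) * ((s : ℤ) + l + 1 - j - γ) := by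
  have hm0 : (m : ℤ) ≠ 0 := by omega
  rw [lamK, if_neg hik, Lam1_eq_of_mem_cellI hμ hj hi, hβ] at hrank
  push_cast [Nat.cast_sub (show j ≤ s + l + 1 by omega)] at hrank
  refine mul_left_cancel₀ hm0 (hrank.trans ?_)
  ring

/-- For `m > 1` the rank equation keeps `β` at the decremented position away from multiples
of `m`. -/
theorem ne_mul_of_rank_eq {μ s l ρ m k M γ : ℕ} {β : ℕ → ℕ} (hμ : 1 ≤ μ) (hρ : 1 ≤ ρ)
    (hm : 1 < m) (hgcd : Nat.gcd m (μ + 1) = 1) (hk : k ≤ l)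
    (hrank : (m : ℤ) * ((rank M β (ρ + k * μ) : ℤ) - ((ρ + k * μ : ℕ) : ℤ)) =
      ((μ : ℤ) + 1) * ((lamK μ s l ρ m k (ρ + k * μ) : ℤ) - (β (ρ + k * μ) : ℤ))) :
    β (ρ + k * μ) ≠ m * γ := by
  intro hβ
  have hmem : ρ + k * μ ∈ cellI ρ μ k := by
    refine mem_cellI_iff.2 ⟨by omega, le_rfl, fun hk0 => ?_⟩
    obtain ⟨k, rfl⟩ := Nat.exists_eq_succ_of_ne_zero hk0
    rw [Nat.succ_sub_one, Nat.succ_mul]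
    omega
  have hpos : 1 ≤ m * (s + l + 1 - k) := Nat.mul_pos (by omega) (by omega)
  rw [lamK, if_pos rfl, Lam1_eq_of_mem_cellI hμ hk hmem, hβ, Nat.cast_sub hpos] at hrank
  have hcop : IsCoprime (m : ℤ) ((μ : ℤ) + 1) := by
    exact_mod_cast Nat.isCoprime_iff_coprime.2 hgcd
  have hdvd := hcop.dvd_of_dvd_mul_left (Dvd.intro _ hrank)
  have hone : (m : ℤ) ∣ 1 := by
    have h := (dvd_mul_right (m : ℤ) (((s + l + 1 - k : ℕ) : ℤ) - γ)).sub hdvd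
    push_cast at h
    ring_nf at h
    exact h
  have := Int.le_of_dvd one_pos hone
  omega

/-- maximum principle, `m > 1` case: under the standing hypothesis on
`λ = Λ(μ,s,l,ρ,m) - ε(ρ+kμ)` and `β`, if `G = {j : 1 ≤ j ≤ L, β_j = mγ}` (with
`m > 1`, or `m = 1` and `ρ+kμ ∉ G`) meets at least two of the cells
`I_0, …, I_l`, then `#G ≤ μ-1`; if moreover one of the cells met is `I_0`,
then `#G ≤ ρ-1`. -/
theorem maximum_principle (μ s l ρ m k : ℕ) (β : ℕ → ℕ)
    (hμ : 1 ≤ μ) (hl : 1 ≤ l) (hρ1 : 1 ≤ ρ) (hρμ : ρ ≤ μ) (hm : 1 ≤ m)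
    (hgcd : Nat.gcd m (μ + 1) = 1) (hk : k ≤ l - 1)
    (L M : ℕ) (hL : L = ρ + l * μ) (hM : M = L + psum (lamK μ s l ρ m k) L)
    (hβ0 : ∀ i, M < i → β i = 0)
    (hdom : trigeq M (lamK μ s l ρ m k) β)
    (hrank : ∀ i ∈ Finset.Icc 1 M,
      (m : ℤ) * ((rank M β i : ℤ) - (i : ℤ)) =
        ((μ : ℤ) + 1) * ((lamK μ s l ρ m k i : ℤ) - (β i : ℤ)))
    (γ : ℕ)
    (hcase : 1 < m ∨ (m = 1 ∧ ρ + k * μ ∉ (Finset.Icc 1 L).filter fun j => β j = m * γ))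
    (hmeet : ∃ j₁ j₂ : ℕ, j₁ ≤ l ∧ j₂ ≤ l ∧ j₁ ≠ j₂ ∧
      (((Finset.Icc 1 L).filter fun j => β j = m * γ) ∩ cellI ρ μ j₁).Nonempty ∧
      (((Finset.Icc 1 L).filter fun j => β j = m * γ) ∩ cellI ρ μ j₂).Nonempty) :
    ((Finset.Icc 1 L).filter fun j => β j = m * γ).card ≤ μ - 1 ∧
    ((((Finset.Icc 1 L).filter fun j => β j = m * γ) ∩ cellI ρ μ 0).Nonempty →
      ((Finset.Icc 1 L).filter fun j => β j = m * γ).card ≤ ρ - 1) := by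
  obtain ⟨j₁, j₂, -, -, hne, ⟨x, hx⟩, ⟨y, hy⟩⟩ := hmeet
  have hLM : L ≤ M := by omega
  have hGmem : ∀ i ∈ (Finset.Icc 1 L).filter fun j => β j = m * γ,
      1 ≤ i ∧ i ≤ L ∧ β i = m * γ := by
    intro i hi
    rw [Finset.mem_filter, Finset.mem_Icc] at hi
    exact ⟨hi.1.1, hi.1.2, hi.2⟩
  have hkG : ρ + k * μ ∉ (Finset.Icc 1 L).filter fun j => β j = m * γ := by
    rcases hcase with hm1 | ⟨-, h⟩
    · intro hmem
      obtain ⟨h₁, h₂, h₃⟩ := hGmem _ hmem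
      exact ne_mul_of_rank_eq hμ hρ1 hm1 hgcd (by omega)
        (hrank _ (Finset.mem_Icc.2 ⟨h₁, h₂.trans hLM⟩)) h₃
    · exact h
  set G := (Finset.Icc 1 L).filter fun j => β j = m * γ with hG
  have hGne : G.Nonempty := ⟨x, (Finset.mem_inter.1 hx).1⟩
  have hrankG : ∀ i ∈ G, ∀ j ≤ l, i ∈ cellI ρ μ j →
      (rank M β i : ℤ) - i = ((μ : ℤ) + 1) * ((s : ℤ) + l + 1 - j - γ) := by
    intro i hi j hj hij
    obtain ⟨h₁, h₂, h₃⟩ := hGmem i hi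
    exact rank_eq_of_mem_cellI hμ hm hj hij (fun h => hkG (h ▸ hi)) h₃
      (hrank i (Finset.mem_Icc.2 ⟨h₁, h₂.trans hLM⟩))
  obtain ⟨a, haG, hmin⟩ : ∃ a ∈ G, ∀ j ∈ G, a ≤ j :=
    ⟨G.min' hGne, G.min'_mem hGne, fun j hj => G.min'_le j hj⟩
  obtain ⟨b, hbG, hmax⟩ : ∃ b ∈ G, ∀ j ∈ G, j ≤ b :=
    ⟨G.max' hGne, G.max'_mem hGne, fun j hj => G.le_max' j hj⟩
  obtain ⟨ha₁, ha₂, ha₃⟩ := hGmem a haG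
  obtain ⟨hb₁, hb₂, hb₃⟩ := hGmem b hbG
  obtain ⟨p, hpl, hap⟩ := exists_mem_cellI ha₁ (hL ▸ ha₂)
  obtain ⟨q, hql, hbq⟩ := exists_mem_cellI hb₁ (hL ▸ hb₂)
  have hcard : rank M β a + G.card ≤ rank M β b + 1 := by
    refine rank_add_card_le ha₃ hb₃ (fun j hj hβj => ?_) fun j hj => ?_
    · rw [Finset.mem_Icc] at hj
      have := hmin j (Finset.mem_filter.2 ⟨Finset.mem_Icc.2 ⟨hj.1, hj.2.trans ha₂⟩, hβj⟩)
      omega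
    · obtain ⟨h₁, -, h₃⟩ := hGmem j hj
      exact ⟨h₁, hmax j hj, h₃⟩
  have hcell : ∀ z j, z ∈ G ∩ cellI ρ μ j → p ≤ j ∧ j ≤ q := by
    intro z j hz
    rw [Finset.mem_inter] at hz
    exact ⟨cellI_index_mono hap hz.2 (hmin z hz.1), cellI_index_mono hz.2 hbq (hmax z hz.1)⟩
  have hpq : p < q := by
    have h₁ := hcell x j₁ hx
    have h₂ := hcell y j₂ hy
    omega
  have hra := hrankG a haG p hpl hap
  have hrb := hrankG b hbG q hql hbq
  have hdiff : (G.card : ℤ) ≤ (b - q * μ) - (a - p * μ) - (q - p) + 1 := by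
    zify at hcard
    linarith
  have hbu : (b : ℤ) ≤ ρ + q * μ := by exact_mod_cast (mem_cellI_iff.1 hbq).2.1
  constructor
  · have hal : (ρ : ℤ) - μ + 1 ≤ a - p * μ := by
      rcases p with _ | p
      · push_cast
        omega
      · have h : ρ + p * μ + 1 ≤ a := by simpa using (mem_cellI_iff.1 hap).2.2
        zify at h
        push_cast
        linarith
    omega
  · rintro ⟨z, hz⟩
    obtain rfl : p = 0 := by
      have := (hcell z 0 hz).1
      omega
    simp only [Nat.cast_zero, zero_mul] at hdiff
    omega
end

section
/- Assume the standing hypothesis on λ, β (with 0 ≤ k ≤ l−1, L = ρ+lμ, M = L + |λ|), and suppose m = 1. Let γ ∈ ℕ₀ and G = {j : 1 ≤ j ≤ L, β_j = γ}, and assume G∖{ρ+kμ} has nonempty intersection with at least two of the cells I_0, I_1, …, I_l. If min(G) = ρ+kμ and G ≠ [ρ+kμ, ρ+(k+1)μ], then #G ≤ μ; if min(G) ≠ ρ+kμ (in particular if ρ+kμ ∉ G), then #G ≤ μ−1. -/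
open Finset

/-- Bounds for the modified cell index `c = s + l + 1 - λ_i` of `i`: it is the index of the cell containing `i`,
except that `ρ + kμ` is counted as position `0` of the cell `k + 1`. -/
lemma lamK_one_bounds {μ s l ρ k i : ℕ} (hμ : 1 ≤ μ) (hρμ : ρ ≤ μ) (hkl : k < l)
    (hi : 1 ≤ i) (hiL : i ≤ ρ + l * μ) :
    ∃ c : ℤ, (lamK μ s l ρ 1 k i : ℤ) = s + l + 1 - c ∧ ρ + (c - 1) * μ ≤ i ∧ i ≤ ρ + c * μ ∧
      (i ≠ ρ + k * μ → ρ + (c - 1) * μ < i) := by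
  have key : ∃ c : ℕ, Lam1 μ s l ρ 1 i + c = s + l + 1 ∧
      (ρ : ℤ) + ((c : ℤ) - 1) * μ < i ∧ i ≤ ρ + c * μ := by
    rcases le_or_gt i ρ with h | h
    · refine ⟨0, ?_, ?_, by omega⟩
      · simp [Lam1, h, show i ≠ 0 by omega]
      · push_cast; linarith
    · have hdm := Nat.div_add_mod (i - ρ - 1) μ
      have hmod := Nat.mod_lt (i - ρ - 1) (show 0 < μ by omega)
      have hdl : (i - ρ - 1) / μ < l := (Nat.div_lt_iff_lt_mul (by omega)).2 (by omega)
      have hL : Lam1 μ s l ρ 1 i = s + l - (i - ρ - 1) / μ := by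
        simp [Lam1, show i ≠ 0 by omega, show ¬ i ≤ ρ by omega, hiL]
      rw [hL]
      generalize (i - ρ - 1) / μ = q at *
      generalize (i - ρ - 1) % μ = r at *
      have hi' : i = ρ + 1 + (μ * q + r) := by omega
      refine ⟨q + 1, by omega, ?_, ?_⟩
      · rw [hi']; push_cast; linarith
      · rw [hi']; linarith
  obtain ⟨c, hc, h1, h2⟩ := key
  have h2' : (i : ℤ) ≤ ρ + c * μ := by exact_mod_cast h2
  by_cases hz : i = ρ + k * μ
  · have hz' : (i : ℤ) = ρ + k * μ := by exact_mod_cast hz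
    have hμ' : (1 : ℤ) ≤ μ := by exact_mod_cast hμ
    have hck : c = k := by
      have : (c : ℤ) < k + 1 := by
        by_contra! h
        nlinarith
      have : (k : ℤ) ≤ c := by
        by_contra! h
        nlinarith
      omega
    refine ⟨k + 1, ?_, ?_, ?_, fun h => absurd hz h⟩
    · rw [lamK, if_pos hz]; omega
    · linarith
    · linarith
  · refine ⟨c, ?_, h1.le, h2', fun _ => h1⟩
    rw [lamK, if_neg hz]; omega

lemma cell_le_of_mem {μ ρ c d x : ℤ} (hμ : 1 ≤ μ) (hx : ρ + (c - 1) * μ < x)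
    (hx' : x ≤ ρ + d * μ) : c ≤ d := by
  by_contra! h
  nlinarith

lemma bounds_of_mem_cellI {μ ρ j i : ℕ} (hρμ : ρ ≤ μ) (hi : i ∈ cellI ρ μ j) :
    (ρ : ℤ) + ((j : ℤ) - 1) * μ < i ∧ (i : ℤ) ≤ ρ + j * μ := by
  unfold cellI at hi
  rcases j with _ | j
  · simp only [if_true, Finset.mem_Icc] at hi
    constructor <;> push_cast <;> linarith
  · simp only [Nat.add_one_ne_zero, if_false, Finset.mem_Icc, Nat.add_sub_cancel] at hi
    zify at hi
    constructor <;> push_cast <;> linarith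

/-- Between the least and the greatest index of a level set, the rank grows by one less than the
size of the level set. -/
lemma rank_max_sub_rank_min {M L : ℕ} {β : ℕ → ℕ} {γ a b : ℕ}
    (ha : a ∈ (Finset.Icc 1 L).filter fun j => β j = γ)
    (hb : b ∈ (Finset.Icc 1 L).filter fun j => β j = γ)
    (hmin : ∀ x ∈ (Finset.Icc 1 L).filter fun j => β j = γ, a ≤ x)
    (hmax : ∀ x ∈ (Finset.Icc 1 L).filter fun j => β j = γ, x ≤ b) :
    rank M β b + 1 = rank M β a + ((Finset.Icc 1 L).filter fun j => β j = γ).card := by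
  simp only [Finset.mem_filter, Finset.mem_Icc] at ha hb hmin hmax
  have h1 : ((Finset.Icc 1 a).filter fun j => β j = β a) = {a} := by
    ext x
    simp only [Finset.mem_filter, Finset.mem_Icc, Finset.mem_singleton]
    constructor
    · rintro ⟨⟨h, h'⟩, h''⟩
      exact le_antisymm h' (hmin x ⟨⟨h, by omega⟩, by omega⟩)
    · rintro rfl
      exact ⟨⟨ha.1.1, le_rfl⟩, rfl⟩
  have h2 : ((Finset.Icc 1 b).filter fun j => β j = β b) =
      (Finset.Icc 1 L).filter fun j => β j = γ := by
    ext x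
    simp only [Finset.mem_filter, Finset.mem_Icc, hb.2]
    constructor
    · rintro ⟨⟨h, h'⟩, h''⟩
      exact ⟨⟨h, by omega⟩, h''⟩
    · intro h
      exact ⟨⟨h.1.1, hmax x h⟩, h.2⟩
  rw [rank, rank, h1, h2, hb.2, ha.2, Finset.card_singleton]
  omega

/-- maximum principle, `m = 1` case: under the standing hypothesis on
`λ = Λ(μ,s,l,ρ,1) - ε(ρ+kμ)` and `β`, if `G = {j : 1 ≤ j ≤ L, β_j = γ}` is such
that `G \ {ρ+kμ}` meets at least two of the cells `I_0, …, I_l`, then: if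
`min G = ρ+kμ` and `G ≠ [ρ+kμ, ρ+(k+1)μ]` then `#G ≤ μ`; if `min G ≠ ρ+kμ`
then `#G ≤ μ-1`. -/
theorem maximum_principle_m_eq_one (μ s l ρ m k : ℕ) (β : ℕ → ℕ)
    (hμ : 1 ≤ μ) (hl : 1 ≤ l) (hρ1 : 1 ≤ ρ) (hρμ : ρ ≤ μ) (hm : 1 ≤ m)
    (hgcd : Nat.gcd m (μ + 1) = 1) (hk : k ≤ l - 1)
    (L M : ℕ) (hL : L = ρ + l * μ) (hM : M = L + psum (lamK μ s l ρ m k) L)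
    (hβ0 : ∀ i, M < i → β i = 0)
    (hdom : trigeq M (lamK μ s l ρ m k) β)
    (hrank : ∀ i ∈ Finset.Icc 1 M,
      (m : ℤ) * ((rank M β i : ℤ) - (i : ℤ)) =
        ((μ : ℤ) + 1) * ((lamK μ s l ρ m k i : ℤ) - (β i : ℤ)))
    (hm1 : m = 1) (γ : ℕ)
    (hmeet : ∃ j₁ j₂ : ℕ, j₁ ≤ l ∧ j₂ ≤ l ∧ j₁ ≠ j₂ ∧
      ((((Finset.Icc 1 L).filter fun j => β j = γ).erase (ρ + k * μ)) ∩ cellI ρ μ j₁).Nonempty ∧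
      ((((Finset.Icc 1 L).filter fun j => β j = γ).erase (ρ + k * μ)) ∩ cellI ρ μ j₂).Nonempty) :
    ((((Finset.Icc 1 L).filter fun j => β j = γ).min = ((ρ + k * μ : ℕ) : WithTop ℕ)) →
      ((Finset.Icc 1 L).filter fun j => β j = γ) ≠ Finset.Icc (ρ + k * μ) (ρ + (k + 1) * μ) →
      ((Finset.Icc 1 L).filter fun j => β j = γ).card ≤ μ) ∧
    ((((Finset.Icc 1 L).filter fun j => β j = γ).min ≠ ((ρ + k * μ : ℕ) : WithTop ℕ)) →
      ((Finset.Icc 1 L).filter fun j => β j = γ).card ≤ μ - 1) := by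
  subst hm1
  have hkl : k < l := by omega
  have hμ' : (1 : ℤ) ≤ μ := by exact_mod_cast hμ
  set G := (Finset.Icc 1 L).filter fun j => β j = γ with hG
  obtain ⟨j₁, j₂, -, -, hne, ⟨x₁, hx₁⟩, ⟨x₂, hx₂⟩⟩ := hmeet
  wlog hlt : j₁ < j₂ generalizing j₁ j₂ x₁ x₂
  · exact this j₂ j₁ hne.symm x₂ hx₂ x₁ hx₁ (by omega)
  obtain ⟨h1e, h1c⟩ := Finset.mem_inter.1 hx₁
  obtain ⟨h2e, h2c⟩ := Finset.mem_inter.1 hx₂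
  obtain ⟨-, h1G⟩ := Finset.mem_erase.1 h1e
  obtain ⟨-, h2G⟩ := Finset.mem_erase.1 h2e
  have hGne : G.Nonempty := ⟨x₁, h1G⟩
  have hmaxG := G.max'_mem hGne
  have hminG := G.min'_mem hGne
  have hminle : ∀ x ∈ G, G.min' hGne ≤ x := fun x hx => G.min'_le x hx
  have hlemax : ∀ x ∈ G, x ≤ G.max' hGne := fun x hx => G.le_max' x hx
  have hmineq : G.min = ((G.min' hGne : ℕ) : WithTop ℕ) := (G.coe_min' hGne).symm
  rw [hmineq]
  generalize G.min' hGne = a at *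
  generalize G.max' hGne = b at *
  have hrk := rank_max_sub_rank_min (M := M) hminG hmaxG hminle hlemax
  rw [← hG] at hrk
  have hIcc : ∀ x ∈ G, 1 ≤ x ∧ x ≤ L ∧ β x = γ := by
    intro x hx
    simpa [hG, and_assoc] using hx
  obtain ⟨ha1, haL, haγ⟩ := hIcc a hminG
  obtain ⟨hb1, hbL, hbγ⟩ := hIcc b hmaxG
  have hra := hrank a (Finset.mem_Icc.2 ⟨ha1, by omega⟩)
  have hrb := hrank b (Finset.mem_Icc.2 ⟨hb1, by omega⟩)
  obtain ⟨ca, hca, hal, hau, hast⟩ := lamK_one_bounds (s := s) hμ hρμ hkl ha1 (hL ▸ haL)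
  obtain ⟨cb, hcb, hbl, hbu, hbst⟩ := lamK_one_bounds (s := s) hμ hρμ hkl hb1 (hL ▸ hbL)
  have hb1c := bounds_of_mem_cellI hρμ h1c
  have hb2c := bounds_of_mem_cellI hρμ h2c
  have hax : (a : ℤ) ≤ x₁ := by exact_mod_cast hminle x₁ h1G
  have hxb : (x₂ : ℤ) ≤ b := by exact_mod_cast hlemax x₂ h2G
  have h2b : (j₂ : ℤ) ≤ cb := cell_le_of_mem hμ' hb2c.1 (hxb.trans hbu)
  have hax' : ρ + (ca - 1) * μ < (x₁ : ℤ) := by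
    by_cases hz : a = ρ + k * μ
    · have : a ≠ x₁ := fun h => (Finset.mem_erase.1 h1e).1 (h ▸ hz)
      omega
    · linarith [hast hz]
  have h1a : ca ≤ j₁ := cell_le_of_mem hμ' hax' hb1c.2
  have hcc : ca + 1 ≤ cb := by omega
  have hrk' : (rank M β b : ℤ) + 1 = rank M β a + G.card := by exact_mod_cast hrk
  rw [hca, haγ] at hra
  rw [hcb, hbγ] at hrb
  push_cast at hra hrb
  refine ⟨fun _ _ => ?_, fun hz => ?_⟩
  · zify
    linarith
  · have hz' : a ≠ ρ + k * μ := fun h => hz (by rw [h])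
    have := hast hz'
    have : (G.card : ℤ) < μ := by linarith
    omega
end

section
/- Assume the standing hypothesis on λ, β (with 0 ≤ k ≤ l−1, L = ρ+lμ, M = L + |λ|). Then exactly one of the following holds: (i) β_{L+1} = m and r(β, L+1) = L − μ; or (ii) β_{L+1} = 0, r(β, L+1) = L + 1, and β_j = 0 for all j > L (so ℓ(β) = L). -/
open Finset

/-- Every part of `Λ(μ,s,l,ρ,m)` lies in some cell `I_j`, and there it equals `m(s+l+1-j)`. -/
lemma exists_cell_Lam1_eq {μ s l ρ m i : ℕ} (hμ : 1 ≤ μ) (hρμ : ρ ≤ μ) (hi1 : 1 ≤ i)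
    (hiL : i ≤ ρ + l * μ) :
    ∃ j ≤ l, ρ + j * μ < i + μ ∧ i ≤ ρ + j * μ ∧
      (Lam1 μ s l ρ m i : ℤ) = m * ((s : ℤ) + l + 1 - j) := by
  rcases le_or_gt i ρ with h | h
  · refine ⟨0, by omega, by omega, by omega, ?_⟩
    simp [Lam1, h, show i ≠ 0 by omega]
  · obtain ⟨q, hq⟩ : ∃ q, q = (i - ρ - 1) / μ := ⟨_, rfl⟩
    have hlo : q * μ ≤ i - ρ - 1 := hq ▸ Nat.div_mul_le_self _ _
    have hhi : i - ρ - 1 < q * μ + μ := by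
      have := Nat.lt_div_mul_add (a := i - ρ - 1) (b := μ) hμ
      rwa [← hq] at this
    have hql : q < l := by
      by_contra! hlq
      have := Nat.mul_le_mul_right μ hlq
      omega
    refine ⟨q + 1, hql, ?_, ?_, ?_⟩
    · rw [add_mul]; omega
    · rw [add_mul]; omega
    · simp only [Lam1, show i ≠ 0 by omega, not_le.mpr h, hiL, if_true, if_false, ← hq]
      rw [Nat.cast_mul, Nat.cast_sub (by omega)]
      push_cast
      ring

/-- The shifted parts `m i + (μ+1) Λ_i` increase by at most `m(μ-1)` from left to right. -/
lemma Lam1_shifted_le {μ s l ρ m i i' : ℕ} (hμ : 1 ≤ μ) (hρμ : ρ ≤ μ) (hi1 : 1 ≤ i)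
    (hii : i ≤ i') (hiL : i' ≤ ρ + l * μ) :
    (m : ℤ) * ((i' : ℤ) - i) + ((μ : ℤ) + 1) * ((Lam1 μ s l ρ m i' : ℤ) - Lam1 μ s l ρ m i)
      ≤ m * ((μ : ℤ) - 1) := by
  obtain ⟨j, -, h1, h2, h3⟩ :=
    exists_cell_Lam1_eq (s := s) (m := m) hμ hρμ hi1 (hii.trans hiL)
  obtain ⟨j', -, h1', h2', h3'⟩ :=
    exists_cell_Lam1_eq (s := s) (m := m) hμ hρμ (hi1.trans hii) hiL
  have hjj : j ≤ j' := by
    by_contra! hlt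
    have := Nat.mul_le_mul_right μ (Nat.succ_le_of_lt hlt)
    rw [Nat.succ_mul] at this
    omega
  rw [h3, h3']
  zify at *
  have key : ((i' : ℤ) - i) - (μ + 1) * ((j' : ℤ) - j) ≤ μ - 1 := by linarith
  have := mul_le_mul_of_nonneg_left key (Int.natCast_nonneg m)
  linarith

/-- Entries that are at least `α_i` and not to the right of `i` contribute to the rank of `i`. -/
lemma card_filter_le_rank {M : ℕ} (α : ℕ → ℕ) {i : ℕ} (hi : i ≤ M) :
    ((Icc 1 i).filter fun j => α i ≤ α j).card ≤ rank M α i := by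
  unfold rank
  refine (card_le_card ?_).trans (card_union_le _ _)
  intro j hj
  simp only [mem_filter, mem_union, mem_Icc] at hj ⊢
  omega

/-- Ranks of equal entries differ by the number of equal entries between them. -/
lemma rank_add_card_filter_Ioc {M : ℕ} {α : ℕ → ℕ} {i i' : ℕ} (hi1 : 1 ≤ i) (hii : i ≤ i')
    (hα : α i' = α i) :
    rank M α i + ((Ioc i i').filter fun j => α j = α i).card = rank M α i' := by
  unfold rank
  rw [hα, add_assoc, ← card_union_of_disjoint]
  · congr 2
    ext j
    simp only [mem_filter, mem_union, mem_Icc, mem_Ioc]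
    rcases le_or_gt j i with h | h <;> constructor <;> intro h' <;> try omega
  · rw [disjoint_left]
    intro j
    simp only [mem_filter, mem_Icc, mem_Ioc]
    omega

/-- Away from the perturbed part `p`, each value is taken at most `μ` times by `β` on `[1,L]`. -/
lemma card_level_le {μ s l ρ m p M : ℕ} {β : ℕ → ℕ} (V : ℕ)
    (hμ : 1 ≤ μ) (hρμ : ρ ≤ μ) (hm : 1 ≤ m)
    (hrank : ∀ i ∈ Icc 1 (ρ + l * μ), i ≠ p → (m : ℤ) * ((rank M β i : ℤ) - (i : ℤ)) =
        ((μ : ℤ) + 1) * ((Lam1 μ s l ρ m i : ℤ) - (β i : ℤ))) :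
    ((Icc 1 (ρ + l * μ)).filter fun j => j ≠ p ∧ β j = V).card ≤ μ := by
  set T := (Icc 1 (ρ + l * μ)).filter fun j => j ≠ p ∧ β j = V
  have hmem : ∀ j ∈ T, j ∈ Icc 1 (ρ + l * μ) ∧ j ≠ p ∧ β j = V := fun j hj => mem_filter.mp hj
  rcases T.eq_empty_or_nonempty with h0 | hne
  · simp [h0]
  have hmin := T.min'_mem hne
  have hmax := T.max'_mem hne
  have hii := T.min'_le _ hmax
  have hsub : T.erase (T.min' hne) ⊆
      (Ioc (T.min' hne) (T.max' hne)).filter fun j => β j = β (T.min' hne) := by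
    intro j hj
    rw [mem_erase] at hj
    have h1 := T.min'_le _ hj.2
    have h2 := T.le_max' _ hj.2
    rw [mem_filter, mem_Ioc]
    exact ⟨⟨lt_of_le_of_ne h1 (Ne.symm hj.1), h2⟩, (hmem j hj.2).2.2.trans (hmem _ hmin).2.2.symm⟩
  have hcard := card_le_card hsub
  rw [card_erase_of_mem hmin] at hcard
  clear hsub
  replace hmin := hmem _ hmin
  replace hmax := hmem _ hmax
  generalize T.min' hne = i at *
  generalize T.max' hne = i' at *
  have hβ : β i' = β i := hmax.2.2.trans hmin.2.2.symm
  have hr := rank_add_card_filter_Ioc (M := M) (mem_Icc.mp hmin.1).1 hii hβ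
  have e := hrank i hmin.1 hmin.2.1
  have e' := hrank i' hmax.1 hmax.2.1
  have hc := Lam1_shifted_le (s := s) (m := m) hμ hρμ (mem_Icc.mp hmin.1).1 hii
    (mem_Icc.mp hmax.1).2
  rw [hβ] at e'
  have hle : (m : ℤ) * ((rank M β i' : ℤ) - rank M β i) ≤ m * ((μ : ℤ) - 1) := by linarith
  have := le_of_mul_le_mul_left hle (by omega)
  omega

/-- If `m` divides all values of `β` on `[1,L]` away from `p`, and each such value is taken
at most `μ` times, then at most `μ t + 1` entries are below `m t`. -/
lemma card_lt_le {μ m p L t : ℕ} {β : ℕ → ℕ}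
    (hdvd : ∀ i ∈ Icc 1 L, i ≠ p → m ∣ β i)
    (hlev : ∀ V, ((Icc 1 L).filter fun j => j ≠ p ∧ β j = V).card ≤ μ) :
    ((Icc 1 L).filter fun j => β j < m * t).card ≤ μ * t + 1 := by
  have hsub : ((Icc 1 L).filter fun j => β j < m * t) ⊆
      insert p ((range t).biUnion fun v =>
        (Icc 1 L).filter fun j => j ≠ p ∧ β j = m * v) := by
    intro j hj
    rw [mem_filter] at hj
    by_cases hjp : j = p
    · exact hjp ▸ mem_insert_self _ _
    obtain ⟨v, hv⟩ := hdvd j hj.1 hjp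
    refine mem_insert_of_mem (mem_biUnion.mpr ⟨v, ?_, ?_⟩)
    · exact mem_range.mpr (lt_of_mul_lt_mul_left (hv ▸ hj.2) (Nat.zero_le m))
    · exact mem_filter.mpr ⟨hj.1, hjp, hv⟩
  refine (card_le_card hsub).trans ((card_insert_le _ _).trans ?_)
  have := card_biUnion_le_card_mul (range t)
    (fun v => (Icc 1 L).filter fun j => j ≠ p ∧ β j = m * v) μ fun v _ => hlev _
  rw [card_range, mul_comm] at this
  omega

/-- A vanishing entry `α_i` has rank `i` exactly when nothing to its right is positive. -/
lemma rank_eq_self_iff_of_eq_zero {M : ℕ} {α : ℕ → ℕ} {i : ℕ} (hi : i ≤ M) (hα : α i = 0) :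
    rank M α i = i ↔ ∀ j ∈ Ioc i M, α j = 0 := by
  have hsplit : Icc 1 M = Icc 1 i ∪ Ioc i M := by
    ext j
    simp only [mem_union, mem_Icc, mem_Ioc]
    rcases Nat.eq_zero_or_pos j with h | h <;> omega
  have hdisj : Disjoint (Icc 1 i) (Ioc i M) := by
    rw [disjoint_left]
    intro j
    simp only [mem_Icc, mem_Ioc]
    omega
  have hpart := card_filter_add_card_filter_not (s := Icc 1 i) (fun j => 0 < α j)
  simp only [Nat.card_Icc, not_lt, Nat.le_zero, Nat.add_sub_cancel] at hpart
  have hrank : rank M α i = i + ((Ioc i M).filter fun j => 0 < α j).card := by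
    unfold rank
    rw [hα, hsplit, filter_union, card_union_of_disjoint (disjoint_filter_filter hdisj)]
    omega
  rw [hrank, Nat.add_eq_left, card_eq_zero, filter_eq_empty_iff]
  simp

/-- under the standing hypothesis on `λ = Λ(μ,s,l,ρ,m) - ε(ρ+kμ)` and
`β`, exactly one of the following holds: (i) `β_{L+1} = m` and `r(β,L+1) = L-μ`;
or (ii) `β_{L+1} = 0`, `r(β,L+1) = L+1` and `β_j = 0` for all `j > L`
(so `ℓ(β) = L`). -/
theorem beta_L_plus_one_dichotomy (μ s l ρ m k : ℕ) (β : ℕ → ℕ)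
    (hμ : 1 ≤ μ) (hl : 1 ≤ l) (hρ1 : 1 ≤ ρ) (hρμ : ρ ≤ μ) (hm : 1 ≤ m)
    (hgcd : Nat.gcd m (μ + 1) = 1) (hk : k ≤ l - 1)
    (L M : ℕ) (hL : L = ρ + l * μ) (hM : M = L + psum (lamK μ s l ρ m k) L)
    (hβ0 : ∀ i, M < i → β i = 0)
    (hdom : trigeq M (lamK μ s l ρ m k) β)
    (hrank : ∀ i ∈ Finset.Icc 1 M,
      (m : ℤ) * ((rank M β i : ℤ) - (i : ℤ)) =
        ((μ : ℤ) + 1) * ((lamK μ s l ρ m k i : ℤ) - (β i : ℤ))) :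
    Xor'
      (β (L + 1) = m ∧ rank M β (L + 1) = L - μ)
      (β (L + 1) = 0 ∧ rank M β (L + 1) = L + 1 ∧ (∀ j, L < j → β j = 0) ∧
        lenOf M β = L) := by
  have hkl : k * μ < l * μ := Nat.mul_lt_mul_of_pos_right (by omega) hμ
  have hL1 : 1 ≤ L := by omega
  have hlamL : 1 ≤ lamK μ s l ρ m k L := by
    obtain ⟨j, hj, -, -, h⟩ :=
      exists_cell_Lam1_eq (s := s) (m := m) hμ hρμ (hL ▸ hL1) (le_refl (ρ + l * μ))
    rw [lamK, if_neg (by omega), hL]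
    zify at hm hj ⊢
    rw [h]
    nlinarith
  have hML : L + 1 ≤ M := by
    have : lamK μ s l ρ m k L ≤ psum (lamK μ s l ρ m k) L :=
      single_le_sum (f := lamK μ s l ρ m k) (fun _ _ => Nat.zero_le _)
        (mem_Icc.mpr ⟨hL1, le_refl L⟩)
    omega
  have hrank' : ∀ i ∈ Icc 1 L, i ≠ ρ + k * μ → (m : ℤ) * ((rank M β i : ℤ) - (i : ℤ)) =
      ((μ : ℤ) + 1) * ((Lam1 μ s l ρ m i : ℤ) - (β i : ℤ)) := by
    intro i hi hip
    have := hrank i (Icc_subset_Icc_right (by omega) hi)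
    rwa [lamK, if_neg hip] at this
  have hcop : IsCoprime (m : ℤ) ((μ : ℤ) + 1) := by
    have := Nat.isCoprime_iff_coprime.mpr hgcd
    exact_mod_cast this
  have hdvd : ∀ i ∈ Icc 1 L, i ≠ ρ + k * μ → m ∣ β i := by
    intro i hi hip
    have h1 : (m : ℤ) ∣ (Lam1 μ s l ρ m i : ℤ) - β i :=
      hcop.dvd_of_dvd_mul_left ⟨_, (hrank' i hi hip).symm⟩
    rw [mem_Icc] at hi
    obtain ⟨j, -, -, -, h⟩ :=
      exists_cell_Lam1_eq (s := s) (m := m) hμ hρμ hi.1 (hL ▸ hi.2)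
    have h2 : (m : ℤ) ∣ (Lam1 μ s l ρ m i : ℤ) := ⟨_, h⟩
    exact Int.natCast_dvd_natCast.mp ((dvd_sub_right h2).mp h1)
  have hlamL1 : lamK μ s l ρ m k (L + 1) = 0 := by
    rw [lamK, if_neg (by omega)]
    simp [Lam1, hL, show ¬ ρ + l * μ + 1 ≤ ρ by omega]
  have hR := hrank (L + 1) (mem_Icc.mpr ⟨by omega, hML⟩)
  rw [hlamL1] at hR
  obtain ⟨t, ht⟩ : m ∣ β (L + 1) := by
    have h : (m : ℤ) ∣ ((0 : ℕ) : ℤ) - β (L + 1) := hcop.dvd_of_dvd_mul_left ⟨_, hR.symm⟩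
    rw [Nat.cast_zero, zero_sub, dvd_neg] at h
    exact Int.natCast_dvd_natCast.mp h
  have hRt : rank M β (L + 1) + (μ + 1) * t = L + 1 := by
    have hm0 : (m : ℤ) ≠ 0 := by omega
    have h : (m : ℤ) * ((rank M β (L + 1) : ℤ) + (μ + 1) * t) = m * (L + 1) := by
      rw [ht] at hR
      push_cast at hR
      linarith
    exact_mod_cast mul_left_cancel₀ hm0 h
  have hbelow : ((Icc 1 L).filter fun j => β j < m * t).card ≤ μ * t + 1 := by
    refine card_lt_le hdvd fun V => ?_
    subst hL
    exact card_level_le V hμ hρμ hm hrank'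
  have habove : L + 1 ≤ rank M β (L + 1) + ((Icc 1 L).filter fun j => β j < m * t).card := by
    have h := card_filter_le_rank β hML
    have hpart := card_filter_add_card_filter_not (s := Icc 1 (L + 1)) (fun j => β (L + 1) ≤ β j)
    have hsub : ((Icc 1 (L + 1)).filter fun j => ¬ β (L + 1) ≤ β j) ⊆
        (Icc 1 L).filter fun j => β j < m * t := by
      intro j hj
      rw [mem_filter, mem_Icc, not_le] at hj
      rw [mem_filter, mem_Icc, ← ht]
      have : j ≠ L + 1 := by
        rintro rfl
        exact lt_irrefl _ hj.2
      omega
    have := card_le_card hsub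
    rw [Nat.card_Icc] at hpart
    omega
  have ht1 : t ≤ 1 := by nlinarith
  obtain rfl | rfl : t = 0 ∨ t = 1 := by omega
  · have hzero : β (L + 1) = 0 := by simpa using ht
    have hr : rank M β (L + 1) = L + 1 := by simpa using hRt
    have htail : ∀ j, L < j → β j = 0 := by
      intro j hj
      have h := (rank_eq_self_iff_of_eq_zero hML hzero).mp hr j
      rcases lt_or_ge M j with h' | h'
      · exact hβ0 j h'
      · rcases eq_or_ne j (L + 1) with rfl | hne
        · exact hzero
        · exact h (mem_Ioc.mpr ⟨by omega, h'⟩)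
    have hβL : β L ≠ 0 := by
      intro h
      have hrL := (rank_eq_self_iff_of_eq_zero (by omega : L ≤ M) h).mpr
        fun j hj => htail j (mem_Ioc.mp hj).1
      have e := hrank L (mem_Icc.mpr ⟨hL1, by omega⟩)
      rw [hrL, h, sub_self, mul_zero] at e
      have : (0 : ℤ) < ((μ : ℤ) + 1) * ((lamK μ s l ρ m k L : ℤ) - ((0 : ℕ) : ℤ)) :=
        mul_pos (by omega) (by omega)
      omega
    refine Or.inr ⟨⟨hzero, hr, htail, le_antisymm ?_ ?_⟩, fun h => by omega⟩
    · refine Finset.sup_le fun j hj => ?_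
      by_contra! hlt
      exact (mem_filter.mp hj).2 (htail j hlt)
    · exact le_sup (f := id) (mem_filter.mpr ⟨mem_Icc.mpr ⟨hL1, by omega⟩, hβL⟩)
  · have hm' : β (L + 1) = m := by simpa using ht
    exact Or.inl ⟨⟨hm', by omega⟩, fun h => by omega⟩
end

section
/- Assume the standing hypothesis on λ, β (with 0 ≤ k ≤ l−1, L = ρ+lμ, M = L + |λ|) and suppose β_{L+1} = m. Then β_{ρ+kμ} = m−1, β_i = 0 for all i in the cell I_{k+1}, β_i = m for all L+1 ≤ i ≤ N+l−k, and β_i = 0 for all i > N+l−k; in particular ℓ(β) = N+l−k ≥ N+1. -/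
open Finset

namespace CriticalTail

theorem card_filter_Icc_add_card_filter_Ioc (q : ℕ → Prop) [DecidablePred q] {a b : ℕ}
    (h : a ≤ b) :
    ((Icc 1 a).filter q).card + ((Ioc a b).filter q).card = ((Icc 1 b).filter q).card := by
  rw [← card_union_of_disjoint]
  · congr 1
    ext x
    simp only [mem_union, mem_filter, mem_Icc, mem_Ioc]
    constructor
    · rintro (⟨h1, h2⟩ | ⟨h1, h2⟩) <;> exact ⟨by omega, h2⟩
    · rintro ⟨h1, h2⟩
      by_cases hx : x ≤ a
      · exact Or.inl ⟨by omega, h2⟩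
      · exact Or.inr ⟨by omega, h2⟩
  · rw [disjoint_left]
    intro x
    simp only [mem_filter, mem_Icc, mem_Ioc]
    omega

/-- The rank of `i` exceeds `i` by the number of larger entries to the right of `i` minus the
number of smaller entries to its left. -/
theorem rank_add_card_lt {M : ℕ} (β : ℕ → ℕ) {i : ℕ} (hi : i ≤ M) :
    rank M β i + ((Icc 1 i).filter fun j => β j < β i).card =
      i + ((Ioc i M).filter fun j => β i < β j).card := by
  have h1 := card_filter_Icc_add_card_filter_Ioc (fun j => β i < β j) hi
  have h2 := card_filter_add_card_filter_not (s := Icc 1 i) (fun j => β i < β j)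
  have h3 := card_filter_add_card_filter_not (s := (Icc 1 i).filter fun j => ¬ β i < β j)
    (fun j => β j = β i)
  rw [filter_filter, filter_filter] at h3
  have h4 : ((Icc 1 i).filter fun j => ¬ β i < β j ∧ β j = β i) =
      (Icc 1 i).filter fun j => β j = β i := by
    apply filter_congr; intros; omega
  have h5 : ((Icc 1 i).filter fun j => ¬ β i < β j ∧ ¬ β j = β i) =
      (Icc 1 i).filter fun j => β j < β i := by
    apply filter_congr; intros; omega
  rw [h4, h5] at h3
  rw [Nat.card_Icc] at h2
  unfold rank
  omega

theorem rank_of_eq_zero {M : ℕ} {β : ℕ → ℕ} {i : ℕ} (hi : i ≤ M) (h0 : β i = 0) :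
    rank M β i = i + ((Ioc i M).filter fun j => 0 < β j).card := by
  have h := rank_add_card_lt β hi
  simpa [h0] using h

/-- Coordinates of a position `i`: it is the `t`-th element of the `j`-th block of size `μ`, when
the first `ρ` positions are regarded as the end of block `0`. -/
theorem exists_cell_coords (μ s l ρ m : ℕ) (hμ : 1 ≤ μ) (hρμ : ρ ≤ μ) {i : ℕ} (hi1 : 1 ≤ i)
    (hiL : i ≤ ρ + l * μ) :
    ∃ j t a, i + μ = ρ + j * μ + t ∧ 1 ≤ t ∧ t ≤ μ ∧ a + j = s + l + 1 ∧
      Lam1 μ s l ρ m i = m * a := by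
  by_cases hi : i ≤ ρ
  · refine ⟨0, i + μ - ρ, s + l + 1, by omega, by omega, by omega, by omega, ?_⟩
    simp [Lam1, hi, show i ≠ 0 by omega]
  · have hd := Nat.div_add_mod (i - ρ - 1) μ
    have hm := Nat.mod_lt (i - ρ - 1) (show 0 < μ by omega)
    have hq : (i - ρ - 1) / μ < l := by
      rw [Nat.div_lt_iff_lt_mul (by omega)]
      omega
    set q := (i - ρ - 1) / μ with hqdef
    refine ⟨q + 1, (i - ρ - 1) % μ + 1, s + l - q, ?_, by omega, by omega, by omega, ?_⟩
    · rw [add_mul, mul_comm q μ]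
      omega
    · simp only [Lam1, if_neg (show i ≠ 0 by omega), if_neg hi, if_pos hiL]
      rw [hqdef]

/-- Comparison of the block index with the position. -/
theorem block_le_of_le {μ ρ i i' j j' t t' : ℕ} (h : i + μ = ρ + j * μ + t)
    (h' : i' + μ = ρ + j' * μ + t') (ht : 1 ≤ t) (ht' : t' ≤ μ) (hii : i ≤ i') : j ≤ j' := by
  by_contra! hlt
  have := Nat.mul_le_mul_right μ (Nat.succ_le_of_lt hlt)
  rw [Nat.succ_mul] at this
  omega

/-- Suppose the rank of each element of `Z` exceeds its position by `(μ + 1) a`, where `m a` is the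
corresponding part of `Λ`. If ranks grow at least as fast as the elements of `Z` are counted, then `Z` has at most `μ` elements, with equality only for a full block. -/
theorem card_le_and_eq_block (μ s l ρ : ℕ) {r : ℕ → ℕ} {Z : Finset ℕ}
    (hcoord : ∀ i ∈ Z, ∃ j t a, i + μ = ρ + j * μ + t ∧ 1 ≤ t ∧ t ≤ μ ∧ a + j = s + l + 1 ∧
      r i = i + (μ + 1) * a)
    (hgrow : ∀ i ∈ Z, ∀ i' ∈ Z, i ≤ i' →
      r i + (Z.filter fun x => i < x ∧ x ≤ i').card ≤ r i') :
    Z.card ≤ μ ∧ (μ ≤ Z.card → Z.Nonempty → ∃ i j, Z = Icc i (i + μ - 1) ∧ i + μ = ρ + j * μ + 1 ∧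
      r i + j + μ = ρ + 1 + (μ + 1) * (s + l + 1)) := by
  rcases Z.eq_empty_or_nonempty with rfl | hne
  · simp
  have hmin := Z.min'_mem hne
  have hmax := Z.max'_mem hne
  have hle := Z.min'_le _ hmax
  have hb : ∀ x ∈ Z, Z.min' hne ≤ x ∧ x ≤ Z.max' hne := fun x hx =>
    ⟨Z.min'_le x hx, Z.le_max' x hx⟩
  generalize Z.min' hne = i at *
  generalize Z.max' hne = i' at *
  obtain ⟨j, t, a, hi, ht1, htμ, haj, hr⟩ := hcoord i hmin
  obtain ⟨j', t', a', hi', ht1', htμ', haj', hr'⟩ := hcoord i' hmax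
  have hjj := block_le_of_le hi hi' ht1 htμ' hle
  have hg := hgrow i hmin i' hmax hle
  have hcard : Z.card ≤ (Z.filter fun x => i < x ∧ x ≤ i').card + 1 := by
    refine (card_le_card (t := insert i (Z.filter fun x => i < x ∧ x ≤ i')) ?_).trans
      (card_insert_le _ _)
    intro x hx
    have := hb x hx
    simp only [mem_insert, mem_filter]
    by_cases hxi : x = i
    · exact Or.inl hxi
    · exact Or.inr ⟨hx, by omega, by omega⟩
  have e : r i + j + μ = ρ + t + (μ + 1) * (s + l + 1) := by
    rw [hr, ← haj]
    linear_combination hi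
  have e' : r i' + j' + μ = ρ + t' + (μ + 1) * (s + l + 1) := by
    rw [hr', ← haj']
    linear_combination hi'
  refine ⟨by omega, fun hμZ _ => ⟨i, j, ?_, ?_, ?_⟩⟩
  · have hjeq : j = j' := by omega
    subst hjeq
    apply eq_of_subset_of_card_le
    · intro x hx
      have := hb x hx
      rw [mem_Icc]
      omega
    · rw [Nat.card_Icc]
      omega
  · omega
  · omega

/-- The rank equation at a position where the two parts are `m a` and `m b`, up to a common
shift. -/
theorem eq_add_of_mul_sub_eq {m μ r i a b : ℤ} (hm : 0 < m)
    (h : m * (r - i) = (μ + 1) * (m * a - m * b)) : r = i + (μ + 1) * (a - b) := by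
  apply mul_left_cancel₀ hm.ne'
  linear_combination h

/-- The ranks at `i` and `p` of a vector which, on `[1, M]`, vanishes exactly on a block of
length `μ` and beyond `T`, apart from position `p` where it equals `m - 1`. -/
theorem rank_of_block_shape {M T m μ i p : ℕ} {β : ℕ → ℕ} (hμ : 1 ≤ μ) (hm : 1 ≤ m)
    (hi : 1 ≤ i) (hp : 1 ≤ p) (hpT : p ≤ T) (hiT : i + μ - 1 ≤ T) (hTM : T ≤ M)
    (hpi : p < i ∨ i + μ ≤ p) (hβp : β p = m - 1) (hβT : ∀ x, T < x → β x = 0)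
    (hβI : ∀ x, i ≤ x → x < i + μ → β x = 0)
    (hβm : ∀ x, 1 ≤ x → x ≤ T → x ≠ p → (x < i ∨ i + μ ≤ x) → m ≤ β x) :
    (rank M β i + μ = T + 1 ∧ rank M β p + μ = T) ∨
      (i < p ∧ rank M β i + μ = T ∧ rank M β p = T) := by
  have hri := rank_of_eq_zero (M := M) (β := β) (i := i) (by omega) (hβI i le_rfl (by omega))
  have hrp := rank_add_card_lt (M := M) β (i := p) (by omega)
  rw [hβp] at hrp
  have hcase : ∀ x, x < i ∨ i + μ ≤ x ∨ (i ≤ x ∧ x < i + μ) := by intro x; omega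
  have hval : ∀ x, 1 ≤ x → (T < x ∧ β x = 0) ∨ (i ≤ x ∧ x < i + μ ∧ β x = 0) ∨
      (x = p ∧ β x = m - 1) ∨ (x ≤ T ∧ x ≠ p ∧ (x < i ∨ i + μ ≤ x) ∧ m ≤ β x) := by
    intro x hx
    by_cases h1 : T < x
    · exact Or.inl ⟨h1, hβT x h1⟩
    by_cases h2 : x = p
    · subst h2
      exact Or.inr (Or.inr (Or.inl ⟨rfl, hβp⟩))
    rcases hcase x with h | h | h
    · exact Or.inr (Or.inr (Or.inr ⟨by omega, h2, by omega, hβm x hx (by omega) h2 (by omega)⟩))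
    · exact Or.inr (Or.inr (Or.inr ⟨by omega, h2, by omega, hβm x hx (by omega) h2 (by omega)⟩))
    · exact Or.inr (Or.inl ⟨h.1, h.2, hβI x h.1 h.2⟩)
  rcases hpi with hpi | hpi
  · left
    have e1 : ((Ioc i M).filter fun x => 0 < β x) = Ioc (i + μ - 1) T := by
      ext x
      simp only [mem_filter, mem_Ioc]
      by_cases hx : 1 ≤ x
      · have := hval x hx
        omega
      · omega
    have e2 : ((Ioc p M).filter fun x => m - 1 < β x) = Ioc p (i - 1) ∪ Ioc (i + μ - 1) T := by
      ext x
      simp only [mem_filter, mem_Ioc, mem_union]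
      by_cases hx : 1 ≤ x
      · have := hval x hx
        omega
      · omega
    have e3 : ((Icc 1 p).filter fun x => β x < m - 1) = ∅ := by
      ext x
      simp only [mem_filter, mem_Icc, notMem_empty, iff_false]
      by_cases hx : 1 ≤ x
      · have := hval x hx
        omega
      · omega
    have hdisj : Disjoint (Ioc p (i - 1)) (Ioc (i + μ - 1) T) := by
      rw [disjoint_left]
      intro x
      simp only [mem_Ioc]
      omega
    rw [e1, Nat.card_Ioc] at hri
    rw [e2, e3, card_union_of_disjoint hdisj, card_empty, Nat.card_Ioc, Nat.card_Ioc] at hrp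
    omega
  have e2 : ((Ioc p M).filter fun x => m - 1 < β x) = Ioc p T := by
    ext x
    simp only [mem_filter, mem_Ioc]
    by_cases hx : 1 ≤ x
    · have := hval x hx
      omega
    · omega
  rw [e2, Nat.card_Ioc] at hrp
  by_cases hm1 : m = 1
  · right
    have e1 : ((Ioc i M).filter fun x => 0 < β x) = (Ioc (i + μ - 1) T).erase p := by
      ext x
      simp only [mem_filter, mem_Ioc, mem_erase]
      by_cases hx : 1 ≤ x
      · have := hval x hx
        omega
      · omega
    rw [e1, card_erase_of_mem (by rw [mem_Ioc]; omega), Nat.card_Ioc] at hri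
    have e3 : ((Icc 1 p).filter fun x => β x < m - 1) = ∅ := by
      rw [filter_eq_empty_iff]
      intros
      omega
    rw [e3, card_empty] at hrp
    omega
  · left
    have e1 : ((Ioc i M).filter fun x => 0 < β x) = Ioc (i + μ - 1) T := by
      ext x
      simp only [mem_filter, mem_Ioc]
      by_cases hx : 1 ≤ x
      · have := hval x hx
        omega
      · omega
    have e3 : ((Icc 1 p).filter fun x => β x < m - 1) = Icc i (i + μ - 1) := by
      ext x
      simp only [mem_filter, mem_Icc]
      by_cases hx : 1 ≤ x
      · have := hval x hx
        omega
      · omega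
    rw [e1, Nat.card_Ioc] at hri
    rw [e3, Nat.card_Icc] at hrp
    omega

/-- Within a set of zeros of `β`, ranks grow at least as fast as the elements are counted. -/
theorem rank_add_card_le_rank {M : ℕ} {β : ℕ → ℕ} {Z : Finset ℕ} (hZ : ∀ x ∈ Z, β x = 0)
    {i i' : ℕ} (hi : i ∈ Z) (hi' : i' ∈ Z) (hle : i ≤ i') :
    rank M β i + (Z.filter fun x => i < x ∧ x ≤ i').card ≤ rank M β i' := by
  have h := card_filter_Icc_add_card_filter_Ioc (fun j => β j = 0) hle
  have hsub : (Z.filter fun x => i < x ∧ x ≤ i').card ≤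
      ((Ioc i i').filter fun j => β j = 0).card := by
    apply card_le_card
    intro x hx
    rw [mem_filter] at hx
    rw [mem_filter, mem_Ioc]
    exact ⟨hx.2, hZ x hx.1⟩
  simp only [rank, hZ i hi, hZ i' hi']
  omega

theorem lenOf_le (M : ℕ) (β : ℕ → ℕ) : lenOf M β ≤ M := by
  apply Finset.sup_le
  intro x hx
  exact (mem_Icc.1 (mem_filter.1 hx).1).2

theorem le_lenOf {M : ℕ} {β : ℕ → ℕ} {x : ℕ} (h1 : 1 ≤ x) (hM : x ≤ M) (hx : β x ≠ 0) :
    x ≤ lenOf M β :=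
  Finset.le_sup (f := id) (mem_filter.2 ⟨mem_Icc.2 ⟨h1, hM⟩, hx⟩)

/-- If every zero at a position `x > L` has rank `x`, then no zeros occur between `L` and the
last nonzero position. -/
theorem ne_zero_of_le_lenOf {M L : ℕ} {β : ℕ → ℕ}
    (hfix : ∀ x, L < x → x ≤ M → β x = 0 → rank M β x = x) {x : ℕ} (hL : L < x)
    (hx : x ≤ lenOf M β) : β x ≠ 0 := by
  intro h0
  have hxM : x ≤ M := hx.trans (lenOf_le M β)
  have hr := rank_of_eq_zero hxM h0
  rw [hfix x hL hxM h0, left_eq_add, card_eq_zero, filter_eq_empty_iff] at hr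
  have hlt : lenOf M β < x := by
    rw [lenOf, Finset.sup_lt_iff (show ⊥ < x by simp only [bot_eq_zero']; omega)]
    intro y hy
    rw [mem_filter, mem_Icc] at hy
    by_contra hxy
    rcases eq_or_lt_of_le (not_lt.1 hxy) with h | h
    · exact hy.2 (by simpa [h] using h0)
    · exact hr (mem_Ioc.2 ⟨h, hy.1.2⟩) (Nat.pos_of_ne_zero hy.2)
  omega

end CriticalTail

/-- under the standing hypothesis on `λ = Λ(μ,s,l,ρ,m) - ε(ρ+kμ)` and
`β`, if `β_{L+1} = m` then `β_{ρ+kμ} = m-1`, `β_i = 0` on the cell `I_{k+1}`,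
`β_i = m` for `L+1 ≤ i ≤ N+l-k`, and `β_i = 0` for `i > N+l-k`; in particular
`ℓ(β) = N+l-k ≥ N+1`. -/
theorem beta_description_of_tail (μ s l ρ m k : ℕ) (β : ℕ → ℕ)
    (hμ : 1 ≤ μ) (hl : 1 ≤ l) (hρ1 : 1 ≤ ρ) (hρμ : ρ ≤ μ) (hm : 1 ≤ m)
    (hgcd : Nat.gcd m (μ + 1) = 1) (hk : k ≤ l - 1)
    (L M N : ℕ) (hL : L = ρ + l * μ) (hM : M = L + psum (lamK μ s l ρ m k) L)
    (hN : N = (s + l + 1) * μ + s + ρ)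
    (hβ0 : ∀ i, M < i → β i = 0)
    (hdom : trigeq M (lamK μ s l ρ m k) β)
    (hrank : ∀ i ∈ Finset.Icc 1 M,
      (m : ℤ) * ((rank M β i : ℤ) - (i : ℤ)) =
        ((μ : ℤ) + 1) * ((lamK μ s l ρ m k i : ℤ) - (β i : ℤ)))
    (hβL : β (L + 1) = m) :
    β (ρ + k * μ) = m - 1 ∧
    (∀ i ∈ cellI ρ μ (k + 1), β i = 0) ∧
    (∀ i, L + 1 ≤ i → i ≤ N + l - k → β i = m) ∧
    (∀ i, N + l - k < i → β i = 0) ∧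
    lenOf M β = N + l - k ∧ N + 1 ≤ N + l - k := by
  have hkμ : k * μ + μ ≤ l * μ := by
    rw [← Nat.succ_mul]
    exact Nat.mul_le_mul_right μ (by omega)
  have hLM : L + 1 ≤ M := by
    by_contra h
    have := hβ0 (L + 1) (by omega)
    omega
  set p := ρ + k * μ with hp
  have hm0 : (0 : ℤ) < m := by exact_mod_cast hm
  have hcop : IsCoprime (m : ℤ) ((μ : ℤ) + 1) := by
    have : IsCoprime (m : ℤ) ((μ + 1 : ℕ) : ℤ) := Nat.isCoprime_iff_coprime.2 hgcd
    simpa using this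
  have hdvd : ∀ i, 1 ≤ i → i ≤ M → (m : ℤ) ∣ (lamK μ s l ρ m k i : ℤ) - (β i : ℤ) := by
    intro i h1 hM
    exact hcop.dvd_of_dvd_mul_left ⟨_, (hrank i (mem_Icc.2 ⟨h1, hM⟩)).symm⟩
  have hlam_ne : ∀ i, i ≠ p → lamK μ s l ρ m k i = Lam1 μ s l ρ m i := fun i hi => if_neg hi
  have hlam_tail : ∀ i, L < i → lamK μ s l ρ m k i = 0 := by
    intro i hi
    rw [hlam_ne i (by omega), Lam1, if_neg (by omega), if_neg (by omega), if_neg (by omega)]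
  have hlam_p : lamK μ s l ρ m k p = m * (s + l + 1 - k) - 1 := by
    obtain ⟨j, t, a, h1, h2, h3, h4, h5⟩ :=
      CriticalTail.exists_cell_coords μ s l ρ m hμ hρμ (i := p) (by omega) (by omega)
    have hc : p + μ = ρ + k * μ + μ := by omega
    have hjk := CriticalTail.block_le_of_le h1 hc h2 le_rfl le_rfl
    have hkj := CriticalTail.block_le_of_le hc h1 hμ h3 le_rfl
    have ha : a = s + l + 1 - k := by omega
    rw [lamK, if_pos hp, h5, ha]
  have hmul : ∀ i, 1 ≤ i → i ≤ M → i ≠ p → m ∣ β i := by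
    intro i h1 hM hip
    have h := hdvd i h1 hM
    have hl : (m : ℤ) ∣ (lamK μ s l ρ m k i : ℤ) := by
      by_cases hiL : i ≤ L
      · obtain ⟨_, _, a, _, _, _, _, h5⟩ :=
          CriticalTail.exists_cell_coords μ s l ρ m hμ hρμ h1 (by omega)
        rw [hlam_ne i hip, h5]
        exact ⟨a, by push_cast; ring⟩
      · rw [hlam_tail i (by omega)]
        simp
    exact_mod_cast (dvd_sub_right hl).1 h
  have hsmall : ∀ i, 1 ≤ i → i ≤ M → i ≠ p → β i < m → β i = 0 := fun i h1 hM hip hlt =>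
    Nat.eq_zero_of_dvd_of_lt (hmul i h1 hM hip) hlt
  have hpos : 1 ≤ m * (s + l + 1 - k) := Nat.mul_pos hm (by omega)
  have hpval : β p < m → β p = m - 1 := by
    intro hlt
    have h := hdvd p (by omega) (by omega)
    rw [hlam_p, Nat.cast_sub hpos] at h
    push_cast at h
    have h' : (m : ℤ) ∣ ((β p + 1 : ℕ) : ℤ) := by
      obtain ⟨c, hc⟩ := h
      exact ⟨((s + l + 1 - k : ℕ) : ℤ) - c, by push_cast; linear_combination -hc⟩
    have := Nat.le_of_dvd (by omega) (Int.natCast_dvd_natCast.1 h')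
    omega
  have hTM := CriticalTail.lenOf_le M β
  have hLT : L + 1 ≤ lenOf M β := CriticalTail.le_lenOf (by omega) hLM (by omega)
  have hT0 : ∀ x, lenOf M β < x → β x = 0 := by
    intro x hx
    by_contra h
    by_cases hxM : x ≤ M
    · have := CriticalTail.le_lenOf (by omega) hxM h
      omega
    · exact h (hβ0 x (by omega))
  have hT1 : ∀ x, L < x → x ≤ lenOf M β → β x ≠ 0 := by
    intro x hLx hx
    refine CriticalTail.ne_zero_of_le_lenOf (L := L) ?_ hLx hx
    intro y hLy hyM hy0
    have h := hrank y (mem_Icc.2 ⟨by omega, hyM⟩)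
    rw [hlam_tail y hLy, hy0] at h
    simp only [sub_self, mul_zero, mul_eq_zero, hm0.ne', false_or] at h
    omega
  generalize lenOf M β = T at *
  -- the entries below `m` in the first `L` positions
  have hS : ((Icc 1 L).filter fun j => β j < m).card =
      μ + 1 + ((Ioc (L + 1) M).filter fun j => m < β j).card := by
    have h := hrank (L + 1) (mem_Icc.2 ⟨by omega, hLM⟩)
    rw [hlam_tail (L + 1) (by omega), hβL] at h
    have hr := CriticalTail.eq_add_of_mul_sub_eq (μ := μ) (r := rank M β (L + 1)) (i := L + 1)
        (a := 0) (b := 1) hm0 (by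
      push_cast at h
      linear_combination h)
    have h2 := CriticalTail.rank_add_card_lt β hLM
    have h3 : ((Icc 1 (L + 1)).filter fun j => β j < β (L + 1)) =
        (Icc 1 L).filter fun j => β j < m := by
      ext x
      simp only [mem_filter, mem_Icc, hβL]
      constructor
      · rintro ⟨h1, h2⟩
        have : x ≠ L + 1 := by rintro rfl; omega
        exact ⟨by omega, h2⟩
      · rintro ⟨h1, h2⟩
        exact ⟨by omega, h2⟩
    rw [h3, hβL] at h2
    push_cast at hr
    omega
  set Z := (Icc 1 L).filter fun j => j ≠ p ∧ β j = 0 with hZ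
  have hSZ : ((Icc 1 L).filter fun j => β j < m) ⊆ insert p Z := by
    intro x hx
    rw [mem_filter, mem_Icc] at hx
    rw [mem_insert, hZ, mem_filter, mem_Icc]
    by_cases hxp : x = p
    · exact Or.inl hxp
    · exact Or.inr ⟨hx.1, hxp, hsmall x hx.1.1 (by omega) hxp hx.2⟩
  have hZmem : ∀ x ∈ Z, (1 ≤ x ∧ x ≤ L) ∧ x ≠ p ∧ β x = 0 := by
    intro x hx
    rwa [hZ, mem_filter, mem_Icc] at hx
  have hcardSZ := card_le_card hSZ
  have hpZ : p ∉ Z := fun h => (hZmem p h).2.1 rfl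
  rw [card_insert_of_notMem hpZ] at hcardSZ
  obtain ⟨hZle, hZeq⟩ := CriticalTail.card_le_and_eq_block μ s l ρ (r := rank M β) (Z := Z)
    (by
      intro i hi
      obtain ⟨⟨h1, hL'⟩, hip, h0⟩ := hZmem i hi
      obtain ⟨j, t, a, e1, e2, e3, e4, e5⟩ :=
        CriticalTail.exists_cell_coords μ s l ρ m hμ hρμ h1 (by omega)
      refine ⟨j, t, a, e1, e2, e3, e4, ?_⟩
      have h := hrank i (mem_Icc.2 ⟨h1, by omega⟩)
      rw [hlam_ne i hip, e5, h0] at h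
      have hr := CriticalTail.eq_add_of_mul_sub_eq (μ := μ) (r := rank M β i) (i := i) (a := a) (b := 0) hm0 (by
        push_cast at h
        linear_combination h)
      rw [sub_zero] at hr
      exact_mod_cast hr)
    (fun i hi i' hi' hle =>
      CriticalTail.rank_add_card_le_rank (fun x hx => (hZmem x hx).2.2) hi hi' hle)
  have hZne : Z.Nonempty := card_pos.1 (by omega)
  obtain ⟨i, j, hZI, hij, hri⟩ := hZeq (by omega) hZne
  have hlarge : ((Ioc (L + 1) M).filter fun j => m < β j).card = 0 := by omega
  rw [card_eq_zero, filter_eq_empty_iff] at hlarge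
  have hSeq := eq_of_subset_of_card_le hSZ (by rw [card_insert_of_notMem hpZ]; omega)
  have hβp : β p = m - 1 := by
    have : p ∈ (Icc 1 L).filter fun j => β j < m := by
      rw [hSeq]
      exact mem_insert_self p Z
    exact hpval (mem_filter.1 this).2
  have htail : ∀ x, L < x → x ≤ T → β x = m := by
    intro x hLx hxT
    have hge := Nat.le_of_dvd (Nat.pos_of_ne_zero (hT1 x hLx hxT))
      (hmul x (by omega) (by omega) (by omega))
    by_cases hx : x = L + 1
    · rw [hx, hβL]
    · have := hlarge (x := x) (mem_Ioc.2 ⟨by omega, by omega⟩)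
      omega
  have hblock : ∀ x, i ≤ x → x < i + μ → (1 ≤ x ∧ x ≤ L) ∧ x ≠ p ∧ β x = 0 := by
    intro x h1 h2
    apply hZmem
    rw [hZI, mem_Icc]
    omega
  have hi := hblock i le_rfl (by omega)
  have hi' := hblock (i + μ - 1) (by omega) (by omega)
  have hpi : p < i ∨ i + μ ≤ p := by
    by_contra h
    exact (hblock p (by omega) (by omega)).2.1 rfl
  have hranks := CriticalTail.rank_of_block_shape (M := M) (T := T) (m := m) (μ := μ) (i := i)
    (p := p) (β := β) hμ hm hi.1.1 (by omega) (by omega) (by omega) hTM hpi hβp hT0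
    (fun x h1 h2 => (hblock x h1 h2).2.2) (by
      intro x h1 hxT hxp hxi
      by_cases hxL : x ≤ L
      · by_contra hlt
        have hx0 := hsmall x h1 (by omega) hxp (by omega)
        have : x ∈ Z := by
          rw [hZ, mem_filter, mem_Icc]
          exact ⟨⟨h1, hxL⟩, hxp, hx0⟩
        rw [hZI, mem_Icc] at this
        omega
      · exact (htail x (by omega) hxT).ge)
  have hrp : rank M β p + k = ρ + (μ + 1) * (s + l) := by
    have h := hrank p (mem_Icc.2 ⟨by omega, by omega⟩)
    rw [hlam_p, hβp, Nat.cast_sub hpos, Nat.cast_sub hm] at h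
    have hr := CriticalTail.eq_add_of_mul_sub_eq (μ := μ) (r := rank M β p) (i := p)
      (a := (s + l + 1 - k : ℕ)) (b := 1) hm0 (by
      push_cast at h
      linear_combination h)
    rw [Nat.cast_sub (show k ≤ s + l + 1 by omega), hp] at hr
    zify
    push_cast at hr
    linear_combination hr
  have hcell : (μ + 1) * (s + l + 1) = (μ + 1) * (s + l) + μ + 1 := by ring
  have hNeq : N + l + 1 = (μ + 1) * (s + l) + μ + 1 + ρ := by
    rw [hN]
    ring
  have hjk : j = k + 1 ∧ T = N + l - k := by
    rcases hranks with ⟨h1, h2⟩ | ⟨hip, h1, h2⟩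
    · omega
    · exfalso
      have := CriticalTail.block_le_of_le hij (show p + μ = ρ + k * μ + μ by omega) le_rfl le_rfl
        hip.le
      omega
  obtain ⟨rfl, rfl⟩ := hjk
  refine ⟨hβp, ?_, fun x h1 h2 => htail x (by omega) h2, hT0, rfl, by omega⟩
  intro x hx
  rw [cellI, if_neg (by omega), Nat.add_sub_cancel, mem_Icc] at hx
  rw [Nat.succ_mul] at hx hij
  exact (hblock x (by omega) (by omega)).2.2
end

section
/- Assume the standing hypothesis on λ, β (with 0 ≤ k ≤ l−1, L = ρ+lμ, M = L + |λ|) and suppose β_{L+1} = m. Then β_i = λ_i for all 1 ≤ i < ρ+kμ, and β_i = λ_i + m for all ρ+(k+1)μ+1 ≤ i ≤ ℓ(β) (where λ is padded with zeros, so λ_i = 0 for i > L). -/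
open Finset

theorem sum_le_sum_take_of_sublist {l l' : List ℕ} (h : l'.Sublist l)
    (hl : l.Pairwise (· ≥ ·)) : l'.sum ≤ (l.take l'.length).sum := by
  induction h with
  | slnil => simp
  | @cons l₁ l₂ a h ih =>
    have ih' := ih hl.tail
    rw [List.pairwise_cons] at hl
    rcases hn : l₁.length with _ | n
    · simp [List.length_eq_zero_iff.mp hn]
    · have hlen := h.length_le
      rw [hn, List.sum_take_succ _ _ (by omega)] at ih'
      have := hl.1 l₂[n] (List.getElem_mem _)
      simp only [List.take_succ_cons, List.sum_cons]
      omega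
  | @cons_cons l₁ l₂ a h ih =>
    have ih' := ih hl.tail
    simp only [List.length_cons, List.take_succ_cons, List.sum_cons]
    omega

theorem psum_decRe (M : ℕ) (α : ℕ → ℕ) {j : ℕ} (hj : j ≤ M) :
    psum (decRe M α) j =
      ((List.insertionSort (· ≥ ·) ((List.range M).map fun j => α (j + 1))).take j).sum := by
  induction j with
  | zero => simp [psum]
  | succ j ih =>
    rw [List.sum_take_succ _ _ (by simpa using hj), ← ih (by omega), psum, psum,
      Finset.sum_Icc_succ_top (by omega)]
    congr 1
    simp only [decRe, Nat.add_sub_cancel]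
    exact (List.getElem_eq_getD 0).symm

theorem sum_le_psum_decRe (M : ℕ) (α : ℕ → ℕ) {T : Finset ℕ} (hT : T ⊆ Finset.Icc 1 M) :
    ∑ i ∈ T, α i ≤ psum (decRe M α) T.card := by
  rw [psum_decRe M α (by simpa using Finset.card_le_card hT)]
  have hsub : (T.toList.map α).Subperm ((List.range M).map fun j => α (j + 1)) := by
    have h1 : T.toList.Subperm ((List.range M).map (· + 1)) := by
      refine List.subperm_of_subset T.nodup_toList fun i hi => ?_
      have := Finset.mem_Icc.mp (hT (Finset.mem_toList.mp hi))
      exact List.mem_map.mpr ⟨i - 1, List.mem_range.mpr (by omega), by omega⟩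
    obtain ⟨l, hl, hsub⟩ := h1
    have h2 : (T.toList.map α).Subperm (((List.range M).map (· + 1)).map α) :=
      ⟨l.map α, hl.map α, hsub.map α⟩
    simpa [Function.comp_def] using h2
  have hsort : (List.insertionSort (· ≥ ·) (T.toList.map α)).Sublist
      (List.insertionSort (· ≥ ·) ((List.range M).map fun j => α (j + 1))) :=
    List.sublist_insertionSort' (List.pairwise_insertionSort _ _)
      ((List.perm_insertionSort _ _).subperm_right.mpr hsub)
  have := sum_le_sum_take_of_sublist hsort (List.pairwise_insertionSort _ _)
  rw [(List.perm_insertionSort _ _).sum_eq, Finset.sum_map_toList] at this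
  simpa using this

theorem psum_decRe_of_antitoneOn (M : ℕ) (α : ℕ → ℕ)
    (hα : ∀ i j, 1 ≤ i → i ≤ j → j ≤ M → α j ≤ α i) {j : ℕ} (hj : j ≤ M) :
    psum (decRe M α) j = psum α j := by
  have hsorted : ((List.range M).map fun j => α (j + 1)).Pairwise (· ≥ ·) := by
    rw [List.pairwise_map]
    refine List.Pairwise.imp_of_mem ?_ List.pairwise_lt_range
    intro a b _ hb hab
    exact hα _ _ (by omega) (by omega) (by have := List.mem_range.mp hb; omega)
  refine Finset.sum_congr rfl fun i hi => ?_
  have := Finset.mem_Icc.mp hi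
  rw [decRe, hsorted.insertionSort_eq, List.getD_eq_getElem _ _ (by simp; omega)]
  simp only [List.getElem_map, List.getElem_range]
  congr 1
  omega

theorem sum_le_psum_of_trigeq {M : ℕ} {α β : ℕ → ℕ}
    (hα : ∀ i j, 1 ≤ i → i ≤ j → j ≤ M → α j ≤ α i) (h : trigeq M α β) {T : Finset ℕ}
    (hT : T ⊆ Finset.Icc 1 M) : ∑ i ∈ T, β i ≤ psum α T.card := by
  have hcard : T.card ≤ M := by simpa using Finset.card_le_card hT
  rw [← psum_decRe_of_antitoneOn M α hα hcard]
  refine (sum_le_psum_decRe M β hT).trans ?_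
  rcases h with ⟨-, ⟨-, h⟩ | ⟨h, -⟩⟩ | h
  · rcases Nat.eq_zero_or_pos T.card with h0 | h0
    · simp [h0, psum]
    · exact h _ (Finset.mem_Icc.mpr ⟨h0, hcard⟩)
  · refine (Finset.sum_congr rfl fun i hi => ?_).le
    have := Finset.mem_Icc.mp hi
    exact (h i (Finset.mem_Icc.mpr ⟨this.1, by omega⟩)).symm
  · have : decRe M β = decRe M α := by
      have hmap : ((List.range M).map fun j => β (j + 1)) =
          (List.range M).map fun j => α (j + 1) :=
        List.map_congr_left fun i hi =>
          (h _ (Finset.mem_Icc.mpr ⟨by omega, by have := List.mem_range.mp hi; omega⟩)).symm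
      funext i
      rw [decRe, decRe, hmap]
    rw [this]

theorem psum_eq_of_trigeq {M : ℕ} {α β : ℕ → ℕ} (h : trigeq M α β) : psum α M = psum β M := by
  rcases h with ⟨h, -⟩ | h
  · exact h
  · exact Finset.sum_congr rfl h

theorem card_filter_level {ι : Type*} (T : Finset ι) (x : ι → ℕ) (w : ℕ) :
    (T.filter fun i => w ≤ x i).card =
      (T.filter fun i => w + 1 ≤ x i).card + (T.filter fun i => x i = w).card := by
  classical
  rw [← Finset.card_union_of_disjoint]
  · congr 1
    ext i
    simp only [Finset.mem_filter, Finset.mem_union]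
    grind
  · rw [Finset.disjoint_filter]
    intros
    omega

theorem sum_card_filter_le_eq {ι : Type*} (T : Finset ι) (x : ι → ℕ) (W : ℕ) :
    ∑ w ∈ Finset.Icc 1 W, (T.filter fun i => w ≤ x i).card = ∑ i ∈ T, min W (x i) := by
  simp only [Finset.card_filter]
  rw [Finset.sum_comm]
  refine Finset.sum_congr rfl fun i _ => ?_
  rw [← Finset.card_filter]
  have : (Finset.Icc 1 W).filter (fun w => w ≤ x i) = Finset.Icc 1 (min W (x i)) := by
    ext w
    simp only [Finset.mem_filter, Finset.mem_Icc]
    omega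
  simp [this]

theorem card_Icc_lt_disjUnion {p q U : ℕ} (h1 : 1 ≤ p) (hpq : p ≤ q) (hU : q ≤ U + 1) :
    ((Finset.Icc 1 U).filter fun i => i < p ∨ q ≤ i).card + (q - p) = U := by
  have h : ((Finset.Icc 1 U).filter fun i => i < p ∨ q ≤ i) = Finset.Icc 1 U \ Finset.Ico p q := by
    ext i
    simp only [Finset.mem_filter, Finset.mem_Icc, Finset.mem_sdiff, Finset.mem_Ico]
    grind
  rw [h, Finset.card_sdiff_of_subset (fun i hi => by
    simp only [Finset.mem_Icc, Finset.mem_Ico] at *; omega)]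
  simp
  omega

/-- The last index of a fibre of `β` has rank equal to the number of entries that are at least
as large. -/
theorem rank_of_last {M : ℕ} {β : ℕ → ℕ} {b : ℕ} (hb : b ∈ Finset.Icc 1 M)
    (hlast : ∀ j ∈ Finset.Icc 1 M, β j = β b → j ≤ b) :
    rank M β b = ((Finset.Icc 1 M).filter fun j => β b ≤ β j).card := by
  rw [card_filter_level, rank]
  congr 1
  congr 1
  ext j
  simp only [Finset.mem_filter, Finset.mem_Icc] at *
  grind

/-- The first index of a fibre of `β` has rank one more than the number of larger entries. -/
theorem rank_of_first {M : ℕ} {β : ℕ → ℕ} {a : ℕ} (ha : a ∈ Finset.Icc 1 M)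
    (hfirst : ∀ j ∈ Finset.Icc 1 M, β j = β a → a ≤ j) :
    rank M β a = ((Finset.Icc 1 M).filter fun j => β a < β j).card + 1 := by
  rw [rank]
  congr 1
  rw [Finset.card_eq_one]
  refine ⟨a, ?_⟩
  ext j
  simp only [Finset.mem_filter, Finset.mem_Icc, Finset.mem_singleton] at *
  grind

theorem rank_last_add_one {M : ℕ} {β : ℕ → ℕ} {a b B : ℕ}
    (hb : b ∈ Finset.Icc 1 B) (ha : a ∈ Finset.Icc 1 B) (hab : β a = β b)
    (hlast : ∀ j ∈ Finset.Icc 1 B, β j = β b → j ≤ b)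
    (hfirst : ∀ j ∈ Finset.Icc 1 B, β j = β b → a ≤ j) :
    rank M β b + 1 =
      rank M β a + ((Finset.Icc 1 B).filter fun j => β j = β b).card := by
  have h1 : ((Finset.Icc 1 b).filter fun j => β j = β b) =
      (Finset.Icc 1 B).filter fun j => β j = β b := by
    ext j
    simp only [Finset.mem_filter, Finset.mem_Icc] at *
    grind
  have h2 : ((Finset.Icc 1 a).filter fun j => β j = β b) = {a} := by
    ext j
    simp only [Finset.mem_filter, Finset.mem_Icc, Finset.mem_singleton] at *
    grind
  simp only [rank, hab, h1, h2, Finset.card_singleton]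
  omega

theorem rank_le_card_filter {M : ℕ} {β : ℕ → ℕ} {i : ℕ} (hi : i ∈ Finset.Icc 1 M) :
    rank M β i ≤ ((Finset.Icc 1 M).filter fun j => β i ≤ β j).card := by
  rw [card_filter_level, rank]
  exact add_le_add le_rfl (Finset.card_le_card (Finset.filter_subset_filter _
    (Finset.Icc_subset_Icc_right (Finset.mem_Icc.mp hi).2)))

/-- A composition `β` satisfying the rank equation for `λ = m Λ - ε(ρ+kμ)`, written in terms of
the quotients `Λ` and `y` of `λ` and `β` by `m`. -/
structure CritPair (μ s l ρ m k M : ℕ) (Λ y β : ℕ → ℕ) : Prop where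
  μ_pos : 1 ≤ μ
  ρ_pos : 1 ≤ ρ
  ρ_le : ρ ≤ μ
  m_pos : 1 ≤ m
  k_lt : k < l
  L_lt : ρ + l * μ < M
  pos : ∀ i, 1 ≤ i → i ≤ ρ + l * μ →
    ∃ c e, i + μ = ρ + c * μ + e ∧ 1 ≤ e ∧ e ≤ μ ∧ c ≤ l ∧ Λ i + c = s + l + 1
  zero : ∀ i, ρ + l * μ < i → Λ i = 0
  val : ∀ i ∈ Finset.Icc 1 M, i ≠ ρ + k * μ → β i = m * y i
  val_p : β (ρ + k * μ) + 1 = m * (y (ρ + k * μ) + 1)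
  rank_eq : ∀ i ∈ Finset.Icc 1 M, i ≠ ρ + k * μ →
    (rank M β i : ℤ) = i + ((μ : ℤ) + 1) * ((Λ i : ℤ) - y i)
  rank_p : (rank M β (ρ + k * μ) : ℤ) =
    ((ρ + k * μ : ℕ) : ℤ) + ((μ : ℤ) + 1) * ((Λ (ρ + k * μ) : ℤ) - 1 - y (ρ + k * μ))
  dom : ∀ T ⊆ Finset.Icc 1 M,
    ∑ i ∈ T, β i + (if ρ + k * μ ≤ T.card then 1 else 0) ≤
      m * ∑ i ∈ Finset.Icc 1 T.card, Λ i
  sum_eq : ∑ i ∈ Finset.Icc 1 M, β i + 1 = m * ∑ i ∈ Finset.Icc 1 M, Λ i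
  next : y (ρ + l * μ + 1) = 1

theorem cell_mono {μ ρ i j c c' e e' : ℕ} (hi : i + μ = ρ + c * μ + e) (he : 1 ≤ e)
    (hj : j + μ = ρ + c' * μ + e') (he' : e' ≤ μ) (hij : i ≤ j) : c ≤ c' := by
  by_contra! h
  have : (c' + 1) * μ ≤ c * μ := Nat.mul_le_mul_right _ h
  linarith

theorem cell_unique {μ ρ i c c' e e' : ℕ} (hi : i + μ = ρ + c * μ + e) (he : 1 ≤ e) (he2 : e ≤ μ)
    (hj : i + μ = ρ + c' * μ + e') (he' : 1 ≤ e') (he2' : e' ≤ μ) : c = c' ∧ e = e' := by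
  have hc : c = c' := le_antisymm (cell_mono hi he hj he2' le_rfl) (cell_mono hj he' hi he2 le_rfl)
  subst hc
  exact ⟨rfl, by omega⟩

/-- The number of entries of `y` on `[1, M]` that are at least `w`. -/
def countGe (M : ℕ) (y : ℕ → ℕ) (w : ℕ) : ℕ := ((Finset.Icc 1 M).filter fun j => w ≤ y j).card

theorem countGe_eq_add (M : ℕ) (y : ℕ → ℕ) (w : ℕ) :
    countGe M y w = countGe M y (w + 1) + ((Finset.Icc 1 M).filter fun j => y j = w).card :=
  card_filter_level _ _ _

/-- The value of the quotient of `β` by `m` forced by the rank equation: it agrees with `Λ` before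
index `ρ + kμ`, vanishes on the next `μ + 1` indices, and is `Λ + 1` on the rest of its support. -/
def forcedQuot (μ s l ρ k : ℕ) (Λ : ℕ → ℕ) (i : ℕ) : ℕ :=
  if i < ρ + k * μ then Λ i
  else if i ≤ ρ + k * μ + μ then 0
  else if i ≤ ρ + k * μ + μ + (μ + 1) * (s + l - k) then Λ i + 1
  else 0

namespace CritPair

variable {μ s l ρ m k M : ℕ} {Λ y β : ℕ → ℕ}

theorem p_add_le (h : CritPair μ s l ρ m k M Λ y β) : ρ + k * μ + μ ≤ ρ + l * μ := by
  have : (k + 1) * μ ≤ l * μ := Nat.mul_le_mul_right _ h.k_lt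
  linarith

theorem p_mem (h : CritPair μ s l ρ m k M Λ y β) : ρ + k * μ ∈ Finset.Icc 1 M := by
  have := h.p_add_le
  have := h.L_lt
  have := h.ρ_pos
  exact Finset.mem_Icc.mpr ⟨by omega, by omega⟩

theorem Λ_p (h : CritPair μ s l ρ m k M Λ y β) : Λ (ρ + k * μ) + k = s + l + 1 := by
  have := h.p_add_le
  have := h.ρ_pos
  obtain ⟨c, e, h1, h2, h3, -, h5⟩ := h.pos (ρ + k * μ) (by omega) (by omega)
  obtain ⟨rfl, -⟩ := cell_unique h1 h2 h3 (rfl : _ = ρ + k * μ + μ) h.μ_pos le_rfl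
  exact h5

theorem le_val_iff (h : CritPair μ s l ρ m k M Λ y β) {i : ℕ} (hi : i ∈ Finset.Icc 1 M) (w : ℕ) :
    m * w ≤ β i ↔ w ≤ y i := by
  have hm := h.m_pos
  by_cases hp : i = ρ + k * μ
  · subst hp
    have := h.val_p
    constructor
    · intro hw
      by_contra! hlt
      have := Nat.mul_le_mul_left m hlt
      simp only [Nat.succ_eq_add_one] at this
      omega
    · intro hw
      have := Nat.mul_le_mul_left m hw
      rw [mul_add] at *
      omega
  · rw [h.val i hi hp]
    exact Nat.mul_le_mul_left_iff hm

theorem val_eq_iff (h : CritPair μ s l ρ m k M Λ y β) {i : ℕ} (hi : i ∈ Finset.Icc 1 M)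
    (hp : i ≠ ρ + k * μ) (w : ℕ) : β i = m * w ↔ y i = w := by
  rw [h.val i hi hp]
  exact Nat.mul_right_inj (by have := h.m_pos; omega)

/-- Among the first `L` indices, at least `μ + 1` have a vanishing quotient. -/
theorem succ_add_card_le (h : CritPair μ s l ρ m k M Λ y β) :
    μ + 1 + ((Finset.Icc (ρ + l * μ + 1) M).filter fun j => 2 ≤ y j).card ≤
      ((Finset.Icc 1 (ρ + l * μ)).filter fun j => y j = 0).card := by
  have hm := h.m_pos
  have hL := h.L_lt
  have hp := h.p_add_le
  have hμ := h.μ_pos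
  set L := ρ + l * μ with hLdef
  have hmem : L + 1 ∈ Finset.Icc 1 M := Finset.mem_Icc.mpr ⟨by omega, by omega⟩
  have hr := h.rank_eq (L + 1) hmem (by omega)
  have hβ : β (L + 1) = m := by
    rw [h.val _ hmem (by omega), h.next, mul_one]
  rw [h.zero _ (by omega), h.next] at hr
  have hr' : rank M β (L + 1) + μ = L := by push_cast at hr; zify; linarith
  have hsplit : ((Finset.Icc 1 L).filter fun j => y j = 0).card +
      ((Finset.Icc 1 L).filter fun j => 1 ≤ y j).card = L := by
    have := card_filter_level (Finset.Icc 1 L) y 0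
    simp only [Nat.zero_le, Finset.filter_true, Nat.card_Icc, zero_add] at this
    omega
  have hsub : ((Finset.Icc 1 L).filter fun j => 1 ≤ y j).card + 1 +
      ((Finset.Icc (L + 1) M).filter fun j => 2 ≤ y j).card ≤ rank M β (L + 1) := by
    have h1 : ((Finset.Icc 1 L).filter fun j => β (L + 1) < β j).card +
        ((Finset.Icc (L + 1) M).filter fun j => 2 ≤ y j).card ≤
        ((Finset.Icc 1 M).filter fun j => β (L + 1) < β j).card := by
      rw [← Finset.card_union_of_disjoint]
      · apply Finset.card_le_card
        intro j
        simp only [Finset.mem_union, Finset.mem_filter, Finset.mem_Icc]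
        rintro (⟨h1, h2⟩ | ⟨h1, h2⟩)
        · exact ⟨by omega, h2⟩
        · refine ⟨by omega, ?_⟩
          have := (h.le_val_iff (Finset.mem_Icc.mpr ⟨by omega, h1.2⟩) 2).mpr h2
          omega
      · rw [Finset.disjoint_left]
        intro j
        simp only [Finset.mem_filter, Finset.mem_Icc]
        omega
    have h2 : ((Finset.Icc 1 L).filter fun j => 1 ≤ y j).card + 1 ≤
        ((Finset.Icc 1 L).filter fun j => β (L + 1) < β j).card +
        ((Finset.Icc 1 (L + 1)).filter fun j => β j = β (L + 1)).card := by
      rw [← Finset.insert_Icc_right_eq_Icc_add_one (by omega), Finset.filter_insert, if_pos rfl,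
        Finset.card_insert_of_notMem (by simp), ← add_assoc]
      gcongr
      rw [← Finset.card_union_of_disjoint]
      · apply Finset.card_le_card
        intro j
        simp only [Finset.mem_union, Finset.mem_filter, Finset.mem_Icc]
        rintro ⟨h1, h2⟩
        have := (h.le_val_iff (Finset.mem_Icc.mpr ⟨h1.1, by omega⟩) 1).mpr h2
        omega
      · rw [Finset.disjoint_left]
        intro j
        simp only [Finset.mem_filter, Finset.mem_Icc]
        omega
    rw [rank]
    omega
  omega

/-- For a nonempty fibre of `y` that avoids `ρ + kμ` and lies in `[1, L]`, the positions of its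
first and last elements determine its size. -/
theorem fibre_card (h : CritPair μ s l ρ m k M Λ y β) {B w a b : ℕ} (hBM : B ≤ M)
    (hp : ∀ j ∈ Finset.Icc 1 B, β j = m * w → j ≠ ρ + k * μ ∧ j ≤ ρ + l * μ)
    (ha : a ∈ Finset.Icc 1 B) (hb : b ∈ Finset.Icc 1 B) (hab : a ≤ b)
    (hβa : β a = m * w) (hβb : β b = m * w)
    (hlast : ∀ j ∈ Finset.Icc 1 B, β j = m * w → j ≤ b)
    (hfirst : ∀ j ∈ Finset.Icc 1 B, β j = m * w → a ≤ j) :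
    ∃ c e d e', a + μ = ρ + c * μ + e ∧ b + μ = ρ + (c + d) * μ + e' ∧ 1 ≤ e ∧ e' ≤ μ ∧
      Λ a + c = s + l + 1 ∧
      ((Finset.Icc 1 B).filter fun j => β j = m * w).card + e + d = e' + 1 := by
  obtain ⟨hap, haL⟩ := hp a ha hβa
  obtain ⟨hbp, hbL⟩ := hp b hb hβb
  have ha1 := (Finset.mem_Icc.mp ha).1
  have hb1 := (Finset.mem_Icc.mp hb).1
  have haM : a ∈ Finset.Icc 1 M :=
    Finset.mem_Icc.mpr ⟨ha1, by have := (Finset.mem_Icc.mp ha).2; omega⟩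
  have hbM : b ∈ Finset.Icc 1 M :=
    Finset.mem_Icc.mpr ⟨hb1, by have := (Finset.mem_Icc.mp hb).2; omega⟩
  obtain ⟨c, e, h1, h2, h3, h4, h5⟩ := h.pos a ha1 haL
  obtain ⟨c', e', h1', h2', h3', h4', h5'⟩ := h.pos b hb1 hbL
  obtain ⟨d, rfl⟩ := Nat.exists_eq_add_of_le (cell_mono h1 h2 h1' h3' hab)
  refine ⟨c, e, d, e', h1, h1', h2, h3', h5, ?_⟩
  have hr := rank_last_add_one (M := M) hb ha (hβa.trans hβb.symm) (by rwa [hβb]) (by rwa [hβb])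
  rw [hβb] at hr
  have hra := h.rank_eq a haM hap
  have hrb := h.rank_eq b hbM hbp
  rw [(h.val_eq_iff haM hap w).mp hβa] at hra
  rw [(h.val_eq_iff hbM hbp w).mp hβb] at hrb
  zify at *
  have e1 : (Λ a : ℤ) = s + l + 1 - c := by linarith
  have e2 : (Λ b : ℤ) = s + l + 1 - c - d := by linarith
  rw [e1] at hra
  rw [e2] at hrb
  linarith

theorem zeros_subset_of_one_lt (h : CritPair μ s l ρ m k M Λ y β) (hm : 1 < m) :
    ((Finset.Icc 1 (ρ + l * μ)).filter fun j => y j = 0) ⊆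
      Finset.Icc (ρ + k * μ) (ρ + k * μ + μ) := by
  have hL := h.L_lt
  have hpL := h.p_add_le
  have hμ := h.μ_pos
  have hp := h.p_mem
  have hvp := h.val_p
  have hp1 := (Finset.mem_Icc.mp hp).1
  have hcard := (Nat.le_add_right _ _).trans h.succ_add_card_le
  set p := ρ + k * μ with hpdef
  set L := ρ + l * μ with hLdef
  set Z := (Finset.Icc 1 L).filter fun j => y j = 0 with hZ
  set Z₀ := (Finset.Icc 1 L).filter fun j => β j = m * 0 with hZ₀
  have hβp : β p ≠ 0 := by
    intro h0
    rw [h0, zero_add] at hvp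
    have := Nat.eq_one_of_mul_eq_one_right hvp.symm
    omega
  have hZZ₀ : Z ⊆ insert p Z₀ := by
    intro j hj
    obtain ⟨hj1, hj2⟩ := Finset.mem_filter.mp hj
    by_cases hjp : j = p
    · simp [hjp]
    · have hj3 := Finset.mem_Icc.mp hj1
      exact Finset.mem_insert_of_mem (Finset.mem_filter.mpr ⟨hj1, (h.val_eq_iff
        (Finset.mem_Icc.mpr ⟨hj3.1, by omega⟩) hjp 0).mpr hj2⟩)
  have hZ₀card : Z.card ≤ Z₀.card + 1 :=
    (Finset.card_le_card hZZ₀).trans (Finset.card_insert_le _ _)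
  have hne : Z₀.Nonempty := Finset.card_pos.mp (by omega)
  obtain ⟨ha, hβa⟩ := Finset.mem_filter.mp (Z₀.min'_mem hne)
  obtain ⟨hb, hβb⟩ := Finset.mem_filter.mp (Z₀.max'_mem hne)
  have hfirst : ∀ j ∈ Finset.Icc 1 L, β j = m * 0 → Z₀.min' hne ≤ j := fun j hj hj' =>
    Z₀.min'_le j (Finset.mem_filter.mpr ⟨hj, hj'⟩)
  have hlast : ∀ j ∈ Finset.Icc 1 L, β j = m * 0 → j ≤ Z₀.max' hne := fun j hj hj' =>
    Z₀.le_max' j (Finset.mem_filter.mpr ⟨hj, hj'⟩)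
  have hab := Z₀.min'_le_max' hne
  generalize Z₀.min' hne = a at *
  generalize Z₀.max' hne = b at *
  obtain ⟨c, e, d, e', h1, h2, h3, h4, h5, h6⟩ := h.fibre_card (B := L) (w := 0) (by omega)
    (fun j hj hj' => ⟨by rintro rfl; exact hβp (by simpa using hj'), (Finset.mem_Icc.mp hj).2⟩)
    ha hb hab hβa hβb hlast hfirst
  rw [← hZ₀] at h6
  have hpZ : p ∈ Z := by
    by_contra hpZ
    have := Finset.card_le_card ((Finset.subset_insert_iff_of_notMem hpZ).mp hZZ₀)
    omega
  have hyp : y p = 0 := (Finset.mem_filter.mp hpZ).2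
  obtain rfl : d = 0 := by omega
  obtain rfl : e = 1 := by omega
  obtain rfl : μ = e' := by omega
  rw [hyp, zero_add, mul_one] at hvp
  rw [mul_zero] at hβa hfirst
  have ha' := Finset.mem_Icc.mp ha
  have haM : a ∈ Finset.Icc 1 M := Finset.mem_Icc.mpr ⟨ha'.1, by omega⟩
  have hap : a ≠ p := by rintro rfl; exact hβp hβa
  have hra := rank_of_first (β := β) haM (fun j hj hj' => by
    by_cases hjL : j ≤ L
    · exact hfirst j (Finset.mem_Icc.mpr ⟨(Finset.mem_Icc.mp hj).1, hjL⟩) (by rw [hj', hβa])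
    · omega)
  have hrp := rank_of_first (β := β) hp (fun j hj hj' => by
    by_contra! hlt
    have h0 := h.val j hj (by omega)
    have hlt' : y j < 1 := by
      rw [← not_le, ← h.le_val_iff hj 1]
      omega
    have : y j = 0 := by omega
    rw [this] at h0
    omega)
  have hins : ((Finset.Icc 1 M).filter fun j => β a < β j) =
      insert p ((Finset.Icc 1 M).filter fun j => β p < β j) := by
    ext j
    simp only [Finset.mem_filter, Finset.mem_insert]
    constructor
    · rintro ⟨hj, hj'⟩
      by_cases hjp : j = p
      · exact Or.inl hjp
      · refine Or.inr ⟨hj, ?_⟩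
        by_contra! hlt
        have h0 := h.val j hj hjp
        have hlt' : y j < 1 := by
          rw [← not_le, ← h.le_val_iff hj 1]
          omega
        have : y j = 0 := by omega
        rw [this] at h0
        omega
    · rintro (rfl | ⟨hj, hj'⟩)
      · exact ⟨hp, by omega⟩
      · exact ⟨hj, by omega⟩
  rw [hins, Finset.card_insert_of_notMem (by simp), ← hrp] at hra
  have e1 := h.rank_eq a haM hap
  have e2 := h.rank_p
  rw [(h.val_eq_iff haM hap 0).mp (by simpa using hβa)] at e1
  rw [← hpdef, hyp] at e2
  have hΛp := h.Λ_p
  rw [← hpdef] at hΛp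
  have hc : c = k + 1 := by
    zify at *
    have e3 : (Λ a : ℤ) = s + l + 1 - c := by linarith
    have e4 : (Λ p : ℤ) = s + l + 1 - k := by linarith
    rw [e3] at e1
    rw [e4] at e2
    linarith
  subst hc
  have h7 : (k + 1) * μ = k * μ + μ := by ring
  rw [add_zero] at h2
  intro j hj
  rcases Finset.mem_insert.mp (hZZ₀ hj) with rfl | hj
  · exact Finset.mem_Icc.mpr ⟨le_rfl, by omega⟩
  · obtain ⟨hj, hj'⟩ := Finset.mem_filter.mp hj
    have := hfirst j hj (by simpa using hj')
    have := hlast j hj hj'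
    exact Finset.mem_Icc.mpr ⟨by omega, by omega⟩

theorem zeros_subset_of_eq_one (h : CritPair μ s l ρ m k M Λ y β) (hm : m = 1) :
    ((Finset.Icc 1 (ρ + l * μ)).filter fun j => y j = 0) ⊆
      Finset.Icc (ρ + k * μ) (ρ + k * μ + μ) := by
  subst hm
  have hL := h.L_lt
  have hpL := h.p_add_le
  have hμ := h.μ_pos
  have hp := h.p_mem
  have hp1 := (Finset.mem_Icc.mp hp).1
  have hcard := (Nat.le_add_right _ _).trans h.succ_add_card_le
  have hβy : ∀ j ∈ Finset.Icc 1 M, β j = y j := by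
    intro j hj
    by_cases hjp : j = ρ + k * μ
    · subst hjp
      have := h.val_p
      omega
    · rw [h.val j hj hjp, one_mul]
  set p := ρ + k * μ with hpdef
  set L := ρ + l * μ with hLdef
  have hZeq : ((Finset.Icc 1 L).filter fun j => y j = 0) =
      (Finset.Icc 1 L).filter fun j => β j = 0 := by
    refine Finset.filter_congr fun j hj => ?_
    have := Finset.mem_Icc.mp hj
    rw [hβy j (Finset.mem_Icc.mpr ⟨this.1, by omega⟩)]
  rw [hZeq] at hcard ⊢
  set Z := (Finset.Icc 1 L).filter fun j => β j = 0 with hZ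
  have hne : Z.Nonempty := Finset.card_pos.mp (by omega)
  obtain ⟨ha, hβa⟩ := Finset.mem_filter.mp (Z.min'_mem hne)
  obtain ⟨hb, hβb⟩ := Finset.mem_filter.mp (Z.max'_mem hne)
  have hfirst : ∀ j ∈ Finset.Icc 1 L, β j = 0 → Z.min' hne ≤ j := fun j hj hj' =>
    Z.min'_le j (Finset.mem_filter.mpr ⟨hj, hj'⟩)
  have hlast : ∀ j ∈ Finset.Icc 1 L, β j = 0 → j ≤ Z.max' hne := fun j hj hj' =>
    Z.le_max' j (Finset.mem_filter.mpr ⟨hj, hj'⟩)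
  have hab : Z.min' hne < Z.max' hne := Z.min'_lt_max'_of_card (by omega)
  generalize Z.min' hne = a at *
  generalize Z.max' hne = b at *
  have hr := rank_last_add_one (M := M) hb ha (hβa.trans hβb.symm) (by rwa [hβb]) (by rwa [hβb])
  rw [hβb, ← hZ] at hr
  have key : ∀ i ∈ Finset.Icc 1 L, β i = 0 → ∃ c e, i + μ = ρ + c * μ + e ∧ e ≤ μ ∧
      (1 ≤ e ∨ i = p ∧ c = k + 1 ∧ e = 0) ∧
      (rank M β i : ℤ) = i + ((μ : ℤ) + 1) * (s + l + 1 - c) := by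
    intro i hi hi0
    have hi' := Finset.mem_Icc.mp hi
    have hiM : i ∈ Finset.Icc 1 M := Finset.mem_Icc.mpr ⟨hi'.1, by omega⟩
    by_cases hip : i = p
    · subst hip
      refine ⟨k + 1, 0, by rw [hpdef]; ring, by omega, Or.inr ⟨rfl, rfl, rfl⟩, ?_⟩
      have h1 := h.rank_p
      rw [← hpdef, ← hβy p hp, hi0] at h1
      have h2 := h.Λ_p
      rw [← hpdef] at h2
      have h3 : (Λ p : ℤ) = s + l + 1 - k := by zify at h2; linarith
      rw [h1, h3]
      push_cast
      ring
    · obtain ⟨c, e, h1, h2, h3, -, h5⟩ := h.pos i hi'.1 hi'.2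
      refine ⟨c, e, h1, h3, Or.inl h2, ?_⟩
      rw [h.rank_eq i hiM hip, ← hβy i hiM, hi0]
      have h3 : (Λ i : ℤ) = s + l + 1 - c := by zify at h5; linarith
      rw [h3]
      push_cast
      ring
  obtain ⟨c, e, h1, h2, h3, h4⟩ := key a ha hβa
  obtain ⟨c', e', h1', h2', h3', h4'⟩ := key b hb hβb
  have h7 : (k + 1) * μ = k * μ + μ := by ring
  have hcc : c ≤ c' := by
    rcases h3 with h3 | ⟨rfl, rfl, rfl⟩
    · exact cell_mono h1 h3 h1' h2' hab.le
    · by_contra! hlt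
      have : c' * μ ≤ k * μ := Nat.mul_le_mul_right _ (by omega)
      omega
  obtain ⟨d, rfl⟩ := Nat.exists_eq_add_of_le hcc
  have hz : Z.card + e + d = e' + 1 := by
    zify at *
    linarith
  obtain ⟨rfl, rfl, rfl⟩ : d = 0 ∧ e = 0 ∧ μ = e' := by omega
  obtain ⟨rfl, rfl, -⟩ : a = p ∧ c = k + 1 ∧ 0 = 0 := by omega
  intro j hj
  obtain ⟨hj, hj'⟩ := Finset.mem_filter.mp hj
  have := hfirst j hj hj'
  have := hlast j hj hj'
  rw [add_zero] at h1'
  exact Finset.mem_Icc.mpr ⟨by omega, by omega⟩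

theorem zeros_eq (h : CritPair μ s l ρ m k M Λ y β) :
    ((Finset.Icc 1 (ρ + l * μ)).filter fun j => y j = 0) =
      Finset.Icc (ρ + k * μ) (ρ + k * μ + μ) := by
  have hsub : ((Finset.Icc 1 (ρ + l * μ)).filter fun j => y j = 0) ⊆
      Finset.Icc (ρ + k * μ) (ρ + k * μ + μ) := by
    rcases h.m_pos.eq_or_lt with hm | hm
    · exact h.zeros_subset_of_eq_one hm.symm
    · exact h.zeros_subset_of_one_lt hm
  refine Finset.eq_of_subset_of_card_le hsub ?_
  have := h.succ_add_card_le
  rw [Nat.card_Icc]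
  omega

theorem eq_zero_iff (h : CritPair μ s l ρ m k M Λ y β) {i : ℕ} (h1 : 1 ≤ i)
    (h2 : i ≤ ρ + l * μ) : y i = 0 ↔ ρ + k * μ ≤ i ∧ i ≤ ρ + k * μ + μ := by
  rw [← Finset.mem_Icc, ← h.zeros_eq, Finset.mem_filter, Finset.mem_Icc]
  tauto

theorem le_one_of_lt (h : CritPair μ s l ρ m k M Λ y β) {i : ℕ} (h1 : ρ + l * μ < i)
    (h2 : i ≤ M) : y i ≤ 1 := by
  by_contra! hlt
  have hc := h.succ_add_card_le
  rw [h.zeros_eq, Nat.card_Icc] at hc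
  have : 0 < ((Finset.Icc (ρ + l * μ + 1) M).filter fun j => 2 ≤ y j).card :=
    Finset.card_pos.mpr ⟨i, Finset.mem_filter.mpr ⟨Finset.mem_Icc.mpr ⟨h1, h2⟩, hlt⟩⟩
  omega

/-- The number of positive quotients. -/
theorem card_pos_eq (h : CritPair μ s l ρ m k M Λ y β) :
    ((Finset.Icc 1 M).filter fun j => 1 ≤ y j).card + 1 =
      ρ + k * μ + (μ + 1) * (s + l - k) := by
  have hp := h.p_mem
  have hp1 := (Finset.mem_Icc.mp hp).1
  have hpL := h.p_add_le
  have hyp : y (ρ + k * μ) = 0 := (h.eq_zero_iff hp1 (by omega)).mpr ⟨le_rfl, by omega⟩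
  have hvp := h.val_p
  rw [hyp, zero_add, mul_one] at hvp
  have hr := rank_of_first (β := β) hp (fun j hj hj' => by
    by_contra! hlt
    have h0 : y j ≠ 0 := by
      rw [Ne, h.eq_zero_iff (Finset.mem_Icc.mp hj).1 (by omega)]
      omega
    have := (h.le_val_iff hj 1).mpr (by omega)
    omega)
  have hset : ((Finset.Icc 1 M).filter fun j => β (ρ + k * μ) < β j) =
      (Finset.Icc 1 M).filter fun j => 1 ≤ y j := by
    refine Finset.filter_congr fun j hj => ?_
    rw [← h.le_val_iff hj 1]
    omega
  rw [hset] at hr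
  have h1 := h.rank_p
  rw [hyp, hr] at h1
  have hΛ := h.Λ_p
  have hk := h.k_lt
  have hΛ' : (Λ (ρ + k * μ) : ℤ) = ((s + l - k : ℕ) : ℤ) + 1 := by omega
  rw [hΛ'] at h1
  generalize ((Finset.Icc 1 M).filter fun j => 1 ≤ y j).card = K at *
  zify
  push_cast at h1 ⊢
  linarith

theorem y_p (h : CritPair μ s l ρ m k M Λ y β) : y (ρ + k * μ) = 0 := by
  have hpL := h.p_add_le
  exact (h.eq_zero_iff (Finset.mem_Icc.mp h.p_mem).1 (by omega)).mpr ⟨le_rfl, by omega⟩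

theorem val_eq_iff_of_pos (h : CritPair μ s l ρ m k M Λ y β) {i : ℕ} (hi : i ∈ Finset.Icc 1 M)
    {w : ℕ} (hw : 1 ≤ w) : β i = m * w ↔ y i = w := by
  by_cases hp : i = ρ + k * μ
  · subst hp
    have h1 := h.val_p
    have h2 := h.y_p
    have h3 := Nat.mul_le_mul_left m hw
    rw [h2] at h1 ⊢
    omega
  · exact h.val_eq_iff hi hp w

theorem le_of_two_le (h : CritPair μ s l ρ m k M Λ y β) {i : ℕ} (hi : i ∈ Finset.Icc 1 M)
    (hy : 2 ≤ y i) : i ≤ ρ + l * μ := by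
  by_contra! hlt
  have := h.le_one_of_lt hlt (Finset.mem_Icc.mp hi).2
  omega

theorem card_fibre_le (h : CritPair μ s l ρ m k M Λ y β) {w : ℕ} (hw : 2 ≤ w) :
    ((Finset.Icc 1 M).filter fun j => y j = w).card ≤ μ := by
  have hset : ((Finset.Icc 1 M).filter fun j => y j = w) =
      (Finset.Icc 1 M).filter fun j => β j = m * w :=
    Finset.filter_congr fun j hj => (h.val_eq_iff_of_pos hj (by omega)).symm
  rw [hset]
  set Z := (Finset.Icc 1 M).filter fun j => β j = m * w with hZ
  rcases Z.eq_empty_or_nonempty with hne | hne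
  · simp [hne]
  obtain ⟨ha, hβa⟩ := Finset.mem_filter.mp (Z.min'_mem hne)
  obtain ⟨hb, hβb⟩ := Finset.mem_filter.mp (Z.max'_mem hne)
  obtain ⟨c, e, d, e', -, -, h3, h4, -, h6⟩ := h.fibre_card (B := M) (w := w) le_rfl
    (fun j hj hj' => by
      have hy := (h.val_eq_iff_of_pos hj (by omega)).mp hj'
      refine ⟨?_, h.le_of_two_le hj (by omega)⟩
      rintro rfl
      rw [h.y_p] at hy
      omega)
    ha hb (Z.min'_le_max' hne) hβa hβb
    (fun j hj hj' => Z.le_max' j (Finset.mem_filter.mpr ⟨hj, hj'⟩))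
    (fun j hj hj' => Z.min'_le j (Finset.mem_filter.mpr ⟨hj, hj'⟩))
  rw [← hZ] at h6
  omega

theorem le_Λ_add_iff (h : CritPair μ s l ρ m k M Λ y β) {i : ℕ} (h1 : 1 ≤ i)
    (h2 : i ≤ ρ + l * μ) (c : ℕ) : s + l + 1 ≤ Λ i + c ↔ i ≤ ρ + c * μ := by
  obtain ⟨c', e, h3, h4, h5, -, h7⟩ := h.pos i h1 h2
  constructor
  · intro hc
    have : c' * μ ≤ c * μ := Nat.mul_le_mul_right _ (by omega)
    omega
  · intro hc
    by_contra! hlt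
    have h8 : (c + 1) * μ ≤ c' * μ := Nat.mul_le_mul_right _ (by omega)
    rw [add_mul] at h8
    omega

theorem Λ_le (h : CritPair μ s l ρ m k M Λ y β) {i : ℕ} (h1 : 1 ≤ i) : Λ i ≤ s + l + 1 := by
  by_cases h2 : i ≤ ρ + l * μ
  · obtain ⟨c, e, -, -, -, -, h7⟩ := h.pos i h1 h2
    omega
  · rw [h.zero i (by omega)]
    omega

theorem y_le (h : CritPair μ s l ρ m k M Λ y β) {i : ℕ} (hi : i ∈ Finset.Icc 1 M) :
    y i ≤ s + l + 1 := by
  have h1 := h.dom {i} (by simpa using hi)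
  simp only [Finset.sum_singleton, Finset.card_singleton, Finset.Icc_self] at h1
  have h2 := (h.le_val_iff hi (y i)).mpr le_rfl
  have h3 : m * y i ≤ m * Λ 1 := by omega
  exact (Nat.le_of_mul_le_mul_left h3 h.m_pos).trans (h.Λ_le le_rfl)

theorem countGe_top_le (h : CritPair μ s l ρ m k M Λ y β) : countGe M y (s + l + 1) ≤ ρ := by
  by_contra! hlt
  obtain ⟨T, hT, hTc⟩ := Finset.exists_subset_card_eq hlt
  have hdom := h.dom T (hT.trans (Finset.filter_subset _ _))
  have hlow : T.card • (m * (s + l + 1)) ≤ ∑ i ∈ T, β i :=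
    Finset.card_nsmul_le_sum _ _ _ fun i hi => by
      have := Finset.mem_filter.mp (hT hi)
      exact (h.le_val_iff this.1 _).mpr this.2
  have hlμ : 1 * μ ≤ l * μ := Nat.mul_le_mul_right _ (by have := h.k_lt; omega)
  have hμ := h.μ_pos
  have hup : ∑ i ∈ Finset.Icc 1 T.card, Λ i ≤ ρ * (s + l + 1) + (s + l) := by
    rw [hTc, Finset.sum_Icc_succ_top (by omega)]
    have h1 : ∑ i ∈ Finset.Icc 1 ρ, Λ i ≤ (Finset.Icc 1 ρ).card • (s + l + 1) :=
      Finset.sum_le_card_nsmul _ _ _ fun i hi => h.Λ_le (Finset.mem_Icc.mp hi).1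
    have h2 : ¬ s + l + 1 ≤ Λ (ρ + 1) + 0 := by
      rw [h.le_Λ_add_iff (by omega) (by omega)]
      omega
    simp only [Nat.card_Icc, Nat.add_sub_cancel, smul_eq_mul] at h1
    omega
  have := Nat.mul_le_mul_left m hup
  have hm := h.m_pos
  rw [hTc, smul_eq_mul] at hlow
  have e1 : ρ.succ * (m * (s + l + 1)) = m * (ρ * (s + l + 1) + (s + l)) + m := by
    rw [Nat.succ_eq_add_one]
    ring
  have e2 := (Nat.le_add_right _ _).trans hdom
  omega

theorem countGe_step (h : CritPair μ s l ρ m k M Λ y β) {c : ℕ} (hc : c + 1 < l) :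
    countGe M y (s + l + 1 - (c + 1)) ≤ countGe M y (s + l + 1 - c) + μ := by
  have h1 : s + l + 1 - c = s + l + 1 - (c + 1) + 1 := by omega
  rw [h1, countGe_eq_add]
  have := h.card_fibre_le (w := s + l + 1 - (c + 1)) (by omega)
  omega

theorem countGe_le (h : CritPair μ s l ρ m k M Λ y β) {c : ℕ} (hc : c < l) :
    countGe M y (s + l + 1 - c) ≤ ρ + c * μ := by
  induction c with
  | zero => simpa using h.countGe_top_le
  | succ c ih =>
    have := ih (by omega)
    have := h.countGe_step hc
    rw [add_mul]
    omega

theorem countGe_p_lt (h : CritPair μ s l ρ m k M Λ y β) :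
    countGe M y (s + l + 1 - k) < ρ + k * μ := by
  by_contra! hge
  have hk := h.k_lt
  have hlow : ∀ d, d ≤ k → ρ + (k - d) * μ ≤ countGe M y (s + l + 1 - (k - d)) := by
    intro d
    induction d with
    | zero => intro _; simpa using hge
    | succ d ih =>
      intro hd
      have h1 := ih (by omega)
      have h2 := h.countGe_step (c := k - (d + 1)) (by omega)
      rw [show k - (d + 1) + 1 = k - d by omega] at h2
      have h3 : (k - d) * μ = (k - (d + 1)) * μ + μ := by
        rw [show k - d = k - (d + 1) + 1 by omega, add_mul, one_mul]
      omega
  have hpL := h.p_add_le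
  have hm := h.m_pos
  have hcard : countGe M y (s + l + 1 - k) = ρ + k * μ := le_antisymm (h.countGe_le hk) hge
  set T := (Finset.Icc 1 M).filter fun j => s + l + 1 - k ≤ y j with hT
  have hTc : T.card = ρ + k * μ := hcard
  have hTsub : T ⊆ Finset.Icc 1 M := Finset.filter_subset _ _
  have hdom := h.dom T hTsub
  rw [hTc, if_pos le_rfl] at hdom
  have h1 : m * ∑ i ∈ T, y i ≤ ∑ i ∈ T, β i := by
    rw [Finset.mul_sum]
    exact Finset.sum_le_sum fun i hi => (h.le_val_iff (hTsub hi) _).mpr le_rfl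
  have h2 : ∑ i ∈ Finset.Icc 1 (ρ + k * μ), Λ i ≤ ∑ i ∈ T, y i := by
    have e1 : ∑ i ∈ Finset.Icc 1 (ρ + k * μ), Λ i =
        ∑ i ∈ Finset.Icc 1 (ρ + k * μ), min (s + l + 1) (Λ i) :=
      Finset.sum_congr rfl fun i hi => (min_eq_right (h.Λ_le (Finset.mem_Icc.mp hi).1)).symm
    have e2 : ∑ i ∈ T, y i = ∑ i ∈ T, min (s + l + 1) (y i) :=
      Finset.sum_congr rfl fun i hi => (min_eq_right (h.y_le (hTsub hi))).symm
    rw [e1, e2, ← sum_card_filter_le_eq, ← sum_card_filter_le_eq]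
    refine Finset.sum_le_sum fun w hw => ?_
    have hw' := Finset.mem_Icc.mp hw
    by_cases hwv : w ≤ s + l + 1 - k
    · rw [Finset.filter_true_of_mem (s := T) fun i hi => hwv.trans (Finset.mem_filter.mp hi).2, hTc]
      refine (Finset.card_filter_le _ _).trans ?_
      simp
    · obtain ⟨c, hc⟩ : ∃ c, w + c = s + l + 1 := ⟨s + l + 1 - w, by omega⟩
      have h3 := hlow (k - c) (by omega)
      rw [show k - (k - c) = c by omega, show s + l + 1 - c = w by omega] at h3
      have h4 : T.filter (fun i => w ≤ y i) = (Finset.Icc 1 M).filter fun i => w ≤ y i := by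
        rw [hT, Finset.filter_filter]
        refine Finset.filter_congr fun i _ => ?_
        omega
      rw [h4]
      refine le_trans ?_ h3
      have h5 : (Finset.Icc 1 (ρ + k * μ)).filter (fun i => w ≤ Λ i) ⊆
          Finset.Icc 1 (ρ + c * μ) := by
        intro i hi
        obtain ⟨hi1, hi2⟩ := Finset.mem_filter.mp hi
        have hi3 := Finset.mem_Icc.mp hi1
        exact Finset.mem_Icc.mpr ⟨hi3.1, (h.le_Λ_add_iff hi3.1 (by omega) c).mp (by omega)⟩
      simpa using Finset.card_le_card h5
  have h3 := Nat.mul_le_mul_left m h2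
  omega

theorem countGe_lt (h : CritPair μ s l ρ m k M Λ y β) {c : ℕ} (hkc : k ≤ c) (hc : c < l) :
    countGe M y (s + l + 1 - c) < ρ + c * μ := by
  induction c, hkc using Nat.le_induction with
  | base => exact h.countGe_p_lt
  | succ c hkc ih =>
    have := ih (by omega)
    have := h.countGe_step hc
    rw [add_mul]
    omega

theorem Λ_antitone (h : CritPair μ s l ρ m k M Λ y β) {i j : ℕ} (h1 : 1 ≤ i) (hij : i ≤ j) :
    Λ j ≤ Λ i := by
  by_cases hj : j ≤ ρ + l * μ
  · obtain ⟨c, e, a1, a2, a3, -, a5⟩ := h.pos i h1 (by omega)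
    obtain ⟨c', e', b1, b2, b3, -, b5⟩ := h.pos j (by omega) hj
    have := cell_mono a1 a2 b1 b3 hij
    omega
  · rw [h.zero j (by omega)]
    exact Nat.zero_le _

theorem L_le_support (h : CritPair μ s l ρ m k M Λ y β) :
    ρ + l * μ ≤ ρ + k * μ + μ + (μ + 1) * (s + l - k) := by
  obtain ⟨n, rfl⟩ := Nat.exists_eq_add_of_lt h.k_lt
  rw [show s + (k + n + 1) - k = s + n + 1 by omega]
  nlinarith [Nat.zero_le (μ * s)]

theorem support_le (h : CritPair μ s l ρ m k M Λ y β) :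
    ρ + k * μ + μ + (μ + 1) * (s + l - k) ≤ M := by
  have h1 := h.card_pos_eq
  have hL := h.L_lt
  have h2 : ((Finset.Icc 1 M).filter fun j => 1 ≤ y j).card ≤
      ((Finset.Icc 1 (ρ + l * μ)).filter fun j => 1 ≤ y j).card + (M - (ρ + l * μ)) := by
    have hsub : ((Finset.Icc 1 M).filter fun j => 1 ≤ y j) ⊆
        ((Finset.Icc 1 (ρ + l * μ)).filter fun j => 1 ≤ y j) ∪ Finset.Ioc (ρ + l * μ) M := by
      intro j
      simp only [Finset.mem_filter, Finset.mem_union, Finset.mem_Icc, Finset.mem_Ioc]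
      omega
    refine (Finset.card_le_card hsub).trans ((Finset.card_union_le _ _).trans ?_)
    simp
  have h3 := card_filter_level (Finset.Icc 1 (ρ + l * μ)) y 0
  simp only [Nat.zero_le, Finset.filter_true, Nat.card_Icc, zero_add, h.zeros_eq] at h3
  omega

theorem sum_forcedQuot (h : CritPair μ s l ρ m k M Λ y β) :
    ∑ i ∈ Finset.Icc 1 M, forcedQuot μ s l ρ k Λ i + 1 = ∑ i ∈ Finset.Icc 1 M, Λ i := by
  have hp1 := (Finset.mem_Icc.mp h.p_mem).1
  have hpL := h.p_add_le
  have hL := h.L_lt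
  have hQ := h.support_le
  have hLQ := h.L_le_support
  have hΛp := h.Λ_p
  have hk := h.k_lt
  set p := ρ + k * μ with hp
  set Q := p + μ + (μ + 1) * (s + l - k) with hQdef
  have hpt : ∀ i ∈ Finset.Icc 1 M, forcedQuot μ s l ρ k Λ i +
      (if i ∈ Finset.Icc p (p + μ) then Λ i else 0) =
      Λ i + (if i ∈ Finset.Icc (p + μ + 1) Q then 1 else 0) := by
    intro i _
    have hz := h.zero i
    simp only [forcedQuot, Finset.mem_Icc, ← hp, ← hQdef]
    split_ifs <;> omega
  have hsum := Finset.sum_congr rfl hpt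
  rw [Finset.sum_add_distrib, Finset.sum_add_distrib, Finset.sum_ite_mem, Finset.sum_ite_mem,
    Finset.inter_eq_right.mpr (Finset.Icc_subset_Icc hp1 (by omega)),
    Finset.inter_eq_right.mpr (Finset.Icc_subset_Icc (by omega) hQ)] at hsum
  have h1 : ∑ i ∈ Finset.Icc p (p + μ), Λ i = Λ p + μ * (s + l - k) := by
    rw [← Finset.add_sum_Ioc_eq_sum_Icc (by omega)]
    congr 1
    rw [Finset.sum_const_nat (m := s + l - k)]
    · simp
    · intro i hi
      have hi' := Finset.mem_Ioc.mp hi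
      obtain ⟨c, e, b1, b2, b3, -, b5⟩ := h.pos i (by omega) (by omega)
      obtain ⟨rfl, -⟩ := cell_unique b1 b2 b3
        (show i + μ = ρ + (k + 1) * μ + (i - p) by rw [add_mul, one_mul]; omega)
        (by omega) (by omega)
      omega
  have h2 : ∑ i ∈ Finset.Icc (p + μ + 1) Q, 1 = μ * (s + l - k) + (s + l - k) := by
    rw [Finset.sum_const, smul_eq_mul, mul_one, Nat.card_Icc, hQdef, add_mul, one_mul]
    omega
  omega

theorem sum_y (h : CritPair μ s l ρ m k M Λ y β) :
    ∑ i ∈ Finset.Icc 1 M, y i + 1 = ∑ i ∈ Finset.Icc 1 M, Λ i := by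
  have h1 := h.sum_eq
  have h2 : ∑ i ∈ Finset.Icc 1 M, β i + 1 = m * (∑ i ∈ Finset.Icc 1 M, y i + 1) := by
    have hp := h.val_p
    have hp' := h.p_mem
    rw [← Finset.add_sum_erase _ _ hp', ← Finset.add_sum_erase _ y hp',
      Finset.sum_congr rfl (fun i hi => h.val i (Finset.mem_of_mem_erase hi)
        (Finset.ne_of_mem_erase hi)), ← Finset.mul_sum, add_right_comm, hp]
    ring
  exact Nat.eq_of_mul_eq_mul_left h.m_pos (h2.symm.trans h1)

theorem le_countGe_forcedQuot (h : CritPair μ s l ρ m k M Λ y β) {U w : ℕ} (hUM : U ≤ M)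
    (hU : ρ + k * μ + μ ≤ U)
    (hw : ∀ i, 1 ≤ i → i ≤ U → i < ρ + k * μ ∨ ρ + k * μ + μ + 1 ≤ i →
      w ≤ forcedQuot μ s l ρ k Λ i) :
    U ≤ countGe M (forcedQuot μ s l ρ k Λ) w + (μ + 1) := by
  have h1 := card_Icc_lt_disjUnion (U := U) (Finset.mem_Icc.mp h.p_mem).1
    (q := ρ + k * μ + μ + 1) (by omega) (by omega)
  have h2 : ((Finset.Icc 1 U).filter fun i => i < ρ + k * μ ∨ ρ + k * μ + μ + 1 ≤ i).card ≤
      countGe M (forcedQuot μ s l ρ k Λ) w := by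
    apply Finset.card_le_card
    intro i hi
    simp only [Finset.mem_filter, Finset.mem_Icc] at hi ⊢
    exact ⟨by omega, hw i hi.1.1 hi.1.2 hi.2⟩
  omega

theorem forcedQuot_of_gt (h : CritPair μ s l ρ m k M Λ y β) {i : ℕ}
    (h1 : ρ + k * μ + μ < i) (h2 : i ≤ ρ + l * μ) : forcedQuot μ s l ρ k Λ i = Λ i + 1 := by
  have := h.L_le_support
  rw [forcedQuot, if_neg (by omega), if_neg (by omega), if_pos (by omega)]

theorem forcedQuot_of_lt {i : ℕ} (h1 : i < ρ + k * μ) : forcedQuot μ s l ρ k Λ i = Λ i := by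
  rw [forcedQuot, if_pos h1]

theorem countGe_forcedQuot_of_lt (h : CritPair μ s l ρ m k M Λ y β) {c : ℕ} (hc : c < k) :
    ρ + c * μ ≤ countGe M (forcedQuot μ s l ρ k Λ) (s + l + 1 - c) := by
  have hpL := h.p_add_le
  have hL := h.L_lt
  have hμ := h.μ_pos
  have hcμ : (c + 1) * μ ≤ k * μ := Nat.mul_le_mul_right _ hc
  rw [add_mul] at hcμ
  have hsub : Finset.Icc 1 (ρ + c * μ) ⊆
      (Finset.Icc 1 M).filter fun i => s + l + 1 - c ≤ forcedQuot μ s l ρ k Λ i := by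
    intro i hi
    have hi' := Finset.mem_Icc.mp hi
    rw [Finset.mem_filter, Finset.mem_Icc, forcedQuot_of_lt (by omega)]
    have := (h.le_Λ_add_iff hi'.1 (by omega) c).mpr hi'.2
    exact ⟨by omega, by omega⟩
  have hcard := Finset.card_le_card hsub
  rwa [Nat.card_Icc, Nat.add_sub_cancel] at hcard

theorem countGe_forcedQuot_of_ge (h : CritPair μ s l ρ m k M Λ y β) {c : ℕ} (hkc : k ≤ c)
    (hc : c < l) :
    ρ + c * μ ≤ countGe M (forcedQuot μ s l ρ k Λ) (s + l + 1 - c) + 1 := by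
  have hL := h.L_lt
  have hcl : (c + 1) * μ ≤ l * μ := Nat.mul_le_mul_right _ hc
  have hkc' : k * μ ≤ c * μ := Nat.mul_le_mul_right _ hkc
  have hcμ : (c + 1) * μ = c * μ + μ := by ring
  have := h.le_countGe_forcedQuot (U := ρ + (c + 1) * μ) (w := s + l + 1 - c) (by omega) (by omega)
    (by
      intro i hi1 hi2 hi3
      rcases hi3 with hi3 | hi3
      · rw [forcedQuot_of_lt hi3]
        have := (h.le_Λ_add_iff hi1 (by omega) c).mpr (by omega)
        omega
      · rw [h.forcedQuot_of_gt (by omega) (by omega)]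
        have := (h.le_Λ_add_iff hi1 (by omega) (c + 1)).mpr (by omega)
        omega)
  omega

theorem succ_le_Λ (h : CritPair μ s l ρ m k M Λ y β) {i : ℕ} (h1 : 1 ≤ i)
    (h2 : i ≤ ρ + l * μ) : s + 1 ≤ Λ i := by
  have := (h.le_Λ_add_iff h1 h2 l).mpr h2
  omega

theorem countGe_le_forcedQuot (h : CritPair μ s l ρ m k M Λ y β) {w : ℕ} (hw : 1 ≤ w)
    (hw2 : w ≤ s + l + 1) : countGe M y w ≤ countGe M (forcedQuot μ s l ρ k Λ) w := by
  have hL := h.L_lt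
  have hpL := h.p_add_le
  rcases hw.eq_or_lt with rfl | hw1
  · have h1 := h.card_pos_eq
    have h2 := h.le_countGe_forcedQuot (U := ρ + k * μ + μ + (μ + 1) * (s + l - k)) (w := 1)
      h.support_le (by omega) (by
        intro i hi1 hi2 hi3
        rcases hi3 with hi3 | hi3
        · rw [forcedQuot_of_lt hi3]
          have := h.succ_le_Λ hi1 (by omega)
          omega
        · rw [forcedQuot, if_neg (by omega), if_neg (by omega), if_pos hi2]
          omega)
    rw [countGe]
    omega
  by_cases hws : w ≤ s + 1
  · have h2 := h.le_countGe_forcedQuot (U := ρ + l * μ) (w := w) hL.le hpL (by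
        intro i hi1 hi2 hi3
        have := h.succ_le_Λ hi1 hi2
        rcases hi3 with hi3 | hi3
        · rw [forcedQuot_of_lt hi3]
          omega
        · rw [h.forcedQuot_of_gt (by omega) hi2]
          omega)
    have h3 : countGe M y w ≤ ((Finset.Icc 1 (ρ + l * μ)).filter fun j => 1 ≤ y j).card := by
      apply Finset.card_le_card
      intro i hi
      obtain ⟨hi1, hi2⟩ := Finset.mem_filter.mp hi
      exact Finset.mem_filter.mpr ⟨Finset.mem_Icc.mpr ⟨(Finset.mem_Icc.mp hi1).1,
        h.le_of_two_le hi1 (by omega)⟩, by omega⟩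
    have h4 := card_filter_level (Finset.Icc 1 (ρ + l * μ)) y 0
    simp only [Nat.zero_le, Finset.filter_true, Nat.card_Icc, zero_add, h.zeros_eq] at h4
    omega
  · obtain ⟨c, rfl⟩ : ∃ c, w = s + l + 1 - c := ⟨s + l + 1 - w, by omega⟩
    by_cases hck : c < k
    · exact (h.countGe_le (by omega)).trans (h.countGe_forcedQuot_of_lt hck)
    · have h1 := h.countGe_lt (c := c) (by omega) (by omega)
      have h2 := h.countGe_forcedQuot_of_ge (c := c) (by omega) (by omega)
      omega

theorem countGe_eq_forcedQuot (h : CritPair μ s l ρ m k M Λ y β) {w : ℕ} (hw : 1 ≤ w)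
    (hw2 : w ≤ s + l + 1) : countGe M y w = countGe M (forcedQuot μ s l ρ k Λ) w := by
  have hle : ∀ w ∈ Finset.Icc 1 (s + l + 1),
      countGe M y w ≤ countGe M (forcedQuot μ s l ρ k Λ) w := fun w hw =>
    h.countGe_le_forcedQuot (Finset.mem_Icc.mp hw).1 (Finset.mem_Icc.mp hw).2
  refine (Finset.sum_eq_sum_iff_of_le hle).mp (le_antisymm (Finset.sum_le_sum hle) ?_) w
    (Finset.mem_Icc.mpr ⟨hw, hw2⟩)
  simp only [countGe]
  rw [sum_card_filter_le_eq, sum_card_filter_le_eq]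
  have h1 : ∑ i ∈ Finset.Icc 1 M, min (s + l + 1) (y i) = ∑ i ∈ Finset.Icc 1 M, y i :=
    Finset.sum_congr rfl fun i hi => min_eq_right (h.y_le hi)
  have h2 : ∑ i ∈ Finset.Icc 1 M, min (s + l + 1) (forcedQuot μ s l ρ k Λ i) ≤
      ∑ i ∈ Finset.Icc 1 M, forcedQuot μ s l ρ k Λ i :=
    Finset.sum_le_sum fun i _ => min_le_right _ _
  have h3 := h.sum_y
  have h4 := h.sum_forcedQuot
  omega

/-- An entry `y i = s + l + 1 - c` with `c < l` is at most `Λ i`, or at most `Λ i + 1` once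
`k ≤ c`. -/
theorem y_le_Λ_add (h : CritPair μ s l ρ m k M Λ y β) {i c : ℕ} (hi : i ∈ Finset.Icc 1 M)
    (hc : c < l) (hyi : y i + c = s + l + 1) : y i ≤ Λ i + (if c < k then 0 else 1) := by
  set Z := (Finset.Icc 1 M).filter fun j => y j = y i with hZ
  have hne : Z.Nonempty := ⟨i, Finset.mem_filter.mpr ⟨hi, rfl⟩⟩
  obtain ⟨hb, hyb⟩ := Finset.mem_filter.mp (Z.max'_mem hne)
  have hlast : ∀ j ∈ Finset.Icc 1 M, y j = y i → j ≤ Z.max' hne := fun j hj hj' =>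
    Z.le_max' j (Finset.mem_filter.mpr ⟨hj, hj'⟩)
  generalize Z.max' hne = b at *
  have hβb := (h.val_eq_iff_of_pos hb (w := y i) (by omega)).mpr hyb
  have hr := rank_of_last (β := β) hb (fun j hj hj' =>
    hlast j hj ((h.val_eq_iff_of_pos hj (by omega)).mp (hj'.trans hβb)))
  have hset : ((Finset.Icc 1 M).filter fun j => β b ≤ β j) =
      (Finset.Icc 1 M).filter fun j => y i ≤ y j := by
    refine Finset.filter_congr fun j hj => ?_
    rw [hβb, h.le_val_iff hj]
  have hG : rank M β b = countGe M y (s + l + 1 - c) := by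
    rw [hr, hset, countGe, show s + l + 1 - c = y i by omega]
  have hb1 := (Finset.mem_Icc.mp hb).1
  have hbp : b ≠ ρ + k * μ := by
    rintro rfl
    rw [h.y_p] at hyb
    omega
  obtain ⟨c', e, b1, b2, b3, -, b5⟩ := h.pos b hb1 (h.le_of_two_le hb (by omega))
  have hre := h.rank_eq b hb hbp
  have hG' : rank M β b + (if c < k then 0 else 1) = ρ + c * μ := by
    have h1 := h.countGe_eq_forcedQuot (w := s + l + 1 - c) (by omega) (by omega)
    split_ifs with hck
    · have h2 := h.countGe_le hc
      have h3 := h.countGe_forcedQuot_of_lt hck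
      omega
    · have h2 := h.countGe_lt (by omega) hc
      have h3 := h.countGe_forcedQuot_of_ge (by omega) hc
      omega
  have hanti := h.Λ_antitone (Finset.mem_Icc.mp hi).1 (hlast i hi rfl)
  refine le_trans ?_ (Nat.add_le_add_right hanti _)
  rw [hyb] at hre
  generalize (if c < k then 0 else 1) = δ at *
  zify at *
  have e1 : (Λ b : ℤ) = s + l + 1 - c' := by linarith
  have e2 : (y i : ℤ) = s + l + 1 - c := by linarith
  rw [e1, e2] at hre
  linarith

theorem y_le_forcedQuot (h : CritPair μ s l ρ m k M Λ y β) {i : ℕ} (hi : i ∈ Finset.Icc 1 M) :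
    y i ≤ forcedQuot μ s l ρ k Λ i := by
  have hi' := Finset.mem_Icc.mp hi
  have hpL := h.p_add_le
  have hy := h.y_le hi
  by_cases hiL : i ≤ ρ + l * μ
  · by_cases hz : y i = 0
    · omega
    have hz' := hz
    rw [h.eq_zero_iff hi'.1 hiL] at hz'
    have hs := h.succ_le_Λ hi'.1 hiL
    have hc : s + 2 ≤ y i → y i ≤ Λ i + (if s + l + 1 - y i < k then 0 else 1) := fun hy2 =>
      h.y_le_Λ_add hi (by omega) (by omega)
    by_cases hip : i < ρ + k * μ
    · rw [forcedQuot_of_lt hip]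
      have := (h.le_Λ_add_iff hi'.1 hiL k).mpr hip.le
      split_ifs at hc <;> omega
    · rw [h.forcedQuot_of_gt (by omega) hiL]
      split_ifs at hc <;> omega
  · have h1 := h.le_one_of_lt (by omega) hi'.2
    by_cases hz : y i = 0
    · omega
    have hyi : y i = 1 := by omega
    have hr := h.rank_eq i hi (by omega)
    have hle := rank_le_card_filter (β := β) hi
    have hset : ((Finset.Icc 1 M).filter fun j => β i ≤ β j) =
        (Finset.Icc 1 M).filter fun j => 1 ≤ y j := by
      refine Finset.filter_congr fun j hj => ?_
      rw [(h.val_eq_iff_of_pos hi le_rfl).mpr hyi, h.le_val_iff hj]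
    rw [hset] at hle
    have hK := h.card_pos_eq
    rw [hyi, h.zero i (by omega)] at hr
    have hr' : rank M β i + (μ + 1) = i := by
      zify
      push_cast at hr
      linarith
    rw [forcedQuot, if_neg (by omega), if_neg (by omega), if_pos (by omega)]
    omega

theorem y_eq_forcedQuot (h : CritPair μ s l ρ m k M Λ y β) {i : ℕ} (hi : i ∈ Finset.Icc 1 M) :
    y i = forcedQuot μ s l ρ k Λ i := by
  have h3 := h.sum_y
  have h4 := h.sum_forcedQuot
  exact (Finset.sum_eq_sum_iff_of_le fun i hi => h.y_le_forcedQuot hi).mp (by omega) i hi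

end CritPair


theorem Lam1_eq_mul (μ s l ρ m i : ℕ) : Lam1 μ s l ρ m i = m * Lam1 μ s l ρ 1 i := by
  unfold Lam1
  split_ifs <;> simp

theorem Lam1_of_lt {μ s l ρ i : ℕ} (hi : ρ + l * μ < i) : Lam1 μ s l ρ 1 i = 0 := by
  have : ρ ≤ ρ + l * μ := Nat.le_add_right _ _
  unfold Lam1
  rw [if_neg (by omega), if_neg (by omega), if_neg (by omega)]

theorem exists_Lam1_add_eq {μ s l ρ i : ℕ} (hμ : 1 ≤ μ) (hρ : ρ ≤ μ) (hi : 1 ≤ i)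
    (hiL : i ≤ ρ + l * μ) : ∃ c e, i + μ = ρ + c * μ + e ∧ 1 ≤ e ∧ e ≤ μ ∧ c ≤ l ∧
      Lam1 μ s l ρ 1 i + c = s + l + 1 := by
  unfold Lam1
  rw [if_neg (by omega)]
  by_cases h : i ≤ ρ
  · exact ⟨0, i + μ - ρ, by omega, by omega, by omega, by omega, by simp [h]⟩
  · rw [if_neg h, if_pos hiL]
    have hdiv := Nat.div_add_mod' (i - ρ - 1) μ
    have hmod := Nat.mod_lt (i - ρ - 1) hμ
    have hlt : (i - ρ - 1) / μ < l := by
      rw [Nat.div_lt_iff_lt_mul hμ]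
      omega
    refine ⟨(i - ρ - 1) / μ + 1, (i - ρ - 1) % μ + 1, ?_, by omega, by omega, by omega, by omega⟩
    rw [add_mul]
    omega

theorem Lam1_p {μ s l ρ k : ℕ} (hμ : 1 ≤ μ) (hρ1 : 1 ≤ ρ) (hρ : ρ ≤ μ) (hk : k < l) :
    Lam1 μ s l ρ 1 (ρ + k * μ) + k = s + l + 1 := by
  have hkl : k * μ ≤ l * μ := Nat.mul_le_mul_right _ hk.le
  obtain ⟨c, e, h, he1, he2, -, hΛ⟩ :=
    exists_Lam1_add_eq (s := s) hμ hρ (i := ρ + k * μ) (l := l) (by omega) (by omega)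
  obtain ⟨rfl, -⟩ := cell_unique h he1 he2 rfl hμ le_rfl
  exact hΛ

theorem Lam1_antitone {μ s l ρ i j : ℕ} (hμ : 1 ≤ μ) (hρ : ρ ≤ μ) (hi : 1 ≤ i) (hij : i ≤ j) :
    Lam1 μ s l ρ 1 j ≤ Lam1 μ s l ρ 1 i := by
  rcases lt_or_ge (ρ + l * μ) j with hj | hj
  · simp [Lam1_of_lt hj]
  · obtain ⟨c, e, h, he1, -, -, hΛ⟩ := exists_Lam1_add_eq (s := s) hμ hρ hi (hij.trans hj)
    obtain ⟨c', e', h', -, he2', -, hΛ'⟩ := exists_Lam1_add_eq (s := s) hμ hρ (hi.trans hij) hj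
    have := cell_mono h he1 h' he2' hij
    omega

theorem Lam1_lt_of_p_lt {μ s l ρ k j : ℕ} (hμ : 1 ≤ μ) (hρ1 : 1 ≤ ρ) (hρ : ρ ≤ μ) (hk : k < l)
    (hj : ρ + k * μ < j) : Lam1 μ s l ρ 1 j < Lam1 μ s l ρ 1 (ρ + k * μ) := by
  have hp := Lam1_p (s := s) hμ hρ1 hρ hk
  rcases lt_or_ge (ρ + l * μ) j with hjL | hjL
  · rw [Lam1_of_lt hjL]
    omega
  · obtain ⟨c, e, h, -, he2, -, hΛ⟩ :=
      exists_Lam1_add_eq (s := s) hμ hρ (by omega : 1 ≤ j) hjL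
    have : k < c := by
      by_contra! hck
      have : c * μ ≤ k * μ := Nat.mul_le_mul_right _ hck
      omega
    omega

theorem lamK_add {μ s l ρ m k : ℕ} (hμ : 1 ≤ μ) (hρ1 : 1 ≤ ρ) (hρ : ρ ≤ μ) (hm : 1 ≤ m)
    (hk : k < l) (i : ℕ) :
    lamK μ s l ρ m k i + (if i = ρ + k * μ then 1 else 0) = m * Lam1 μ s l ρ 1 i := by
  have hp := Lam1_p (s := s) hμ hρ1 hρ hk
  rw [← Lam1_eq_mul, lamK]
  split_ifs with h
  · subst h
    have : 1 * 1 ≤ m * Lam1 μ s l ρ 1 (ρ + k * μ) := Nat.mul_le_mul hm (by omega)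
    rw [Lam1_eq_mul]
    omega
  · rfl

theorem lamK_antitone {μ s l ρ m k : ℕ} (hμ : 1 ≤ μ) (hρ1 : 1 ≤ ρ) (hρ : ρ ≤ μ) (hm : 1 ≤ m)
    (hk : k < l) {i j : ℕ} (hi : 1 ≤ i) (hij : i ≤ j) :
    lamK μ s l ρ m k j ≤ lamK μ s l ρ m k i := by
  have h1 := lamK_add (s := s) hμ hρ1 hρ hm hk i
  have h2 := lamK_add (s := s) hμ hρ1 hρ hm hk j
  have hmono := Nat.mul_le_mul_left m (Lam1_antitone (s := s) (l := l) hμ hρ hi hij)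
  rcases hij.eq_or_lt with rfl | hlt
  · rfl
  split_ifs at h1 with h
  · subst h
    have := Nat.mul_le_mul_left m (Nat.succ_le_of_lt (Lam1_lt_of_p_lt (s := s) hμ hρ1 hρ hk hlt))
    rw [Nat.mul_succ] at this
    omega
  · omega

theorem psum_lamK_add {μ s l ρ m k : ℕ} (hμ : 1 ≤ μ) (hρ1 : 1 ≤ ρ) (hρ : ρ ≤ μ) (hm : 1 ≤ m)
    (hk : k < l) (j : ℕ) :
    psum (lamK μ s l ρ m k) j + (if ρ + k * μ ≤ j then 1 else 0) =
      m * ∑ i ∈ Finset.Icc 1 j, Lam1 μ s l ρ 1 i := by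
  rw [Finset.mul_sum, ← Finset.sum_congr rfl fun i _ => lamK_add (s := s) hμ hρ1 hρ hm hk i,
    Finset.sum_add_distrib, psum, Finset.sum_ite_eq']
  have : 1 ≤ ρ + k * μ := by omega
  simp [this]

theorem exists_quot {m a i r lam b Λ d : ℕ} (hm : 1 ≤ m) (hgcd : Nat.gcd m a = 1)
    (hlam : lam + d = m * Λ) (hd : d ≤ 1)
    (h : (m : ℤ) * ((r : ℤ) - i) = (a : ℤ) * ((lam : ℤ) - b)) :
    ∃ v : ℕ, b + d = m * (v + d) ∧ (r : ℤ) = i + (a : ℤ) * ((Λ : ℤ) - d - v) := by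
  have hm0 : (m : ℤ) ≠ 0 := by positivity
  obtain ⟨t, ht⟩ : (m : ℤ) ∣ (lam : ℤ) - b :=
    Int.dvd_of_dvd_mul_right_of_gcd_one ⟨_, h.symm⟩ (by simpa using hgcd)
  have hr : (r : ℤ) - i = a * t := by
    apply mul_left_cancel₀ hm0
    rw [h, ht]
    ring
  have hb : (b : ℤ) + d = m * ((Λ : ℤ) - t) := by
    zify at hlam
    linarith
  have hv : (d : ℤ) ≤ (Λ : ℤ) - t := by
    by_contra! hlt
    have h1 : (m : ℤ) * ((Λ : ℤ) - t) ≤ m * (d - 1) :=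
      mul_le_mul_of_nonneg_left (by omega) (by positivity)
    interval_cases d <;> omega
  obtain ⟨v, hv⟩ := Int.eq_ofNat_of_zero_le (sub_nonneg.mpr hv)
  refine ⟨v, ?_, ?_⟩
  · zify
    rw [hb, ← hv]
    ring
  · rw [← hv]
    linarith

/-- under the standing hypothesis on `λ = Λ(μ,s,l,ρ,m) - ε(ρ+kμ)` and
`β`, if `β_{L+1} = m` then `β_i = λ_i` for all `1 ≤ i < ρ+kμ`, and
`β_i = λ_i + m` for all `ρ+(k+1)μ+1 ≤ i ≤ ℓ(β)` (with `λ` padded by zeros). -/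
theorem beta_matches_lambda (μ s l ρ m k : ℕ) (β : ℕ → ℕ)
    (hμ : 1 ≤ μ) (hl : 1 ≤ l) (hρ1 : 1 ≤ ρ) (hρμ : ρ ≤ μ) (hm : 1 ≤ m)
    (hgcd : Nat.gcd m (μ + 1) = 1) (hk : k ≤ l - 1)
    (L M : ℕ) (hL : L = ρ + l * μ) (hM : M = L + psum (lamK μ s l ρ m k) L)
    (hβ0 : ∀ i, M < i → β i = 0)
    (hdom : trigeq M (lamK μ s l ρ m k) β)
    (hrank : ∀ i ∈ Finset.Icc 1 M,
      (m : ℤ) * ((rank M β i : ℤ) - (i : ℤ)) =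
        ((μ : ℤ) + 1) * ((lamK μ s l ρ m k i : ℤ) - (β i : ℤ)))
    (hβL : β (L + 1) = m) :
    (∀ i, 1 ≤ i → i < ρ + k * μ → β i = lamK μ s l ρ m k i) ∧
    (∀ i, ρ + (k + 1) * μ + 1 ≤ i → i ≤ lenOf M β → β i = lamK μ s l ρ m k i + m) := by
  have hkl : k < l := by omega
  have hLM : L < M := by
    by_contra! h
    have := hβ0 (L + 1) (by omega)
    omega
  have hpM : ρ + k * μ ≤ M := by
    have : k * μ ≤ l * μ := Nat.mul_le_mul_right _ hkl.le
    omega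
  have hpL : ρ + k * μ ≤ ρ + l * μ := by
    have : k * μ ≤ l * μ := Nat.mul_le_mul_right _ hkl.le
    omega
  set p := ρ + k * μ with hp
  have hex : ∀ i, ∃ v : ℕ, i ∈ Finset.Icc 1 M →
      β i + (if i = p then 1 else 0) = m * (v + if i = p then 1 else 0) ∧
      (rank M β i : ℤ) = i + ((μ : ℤ) + 1) *
        ((Lam1 μ s l ρ 1 i : ℤ) - ((if i = p then 1 else 0 : ℕ) : ℤ) - v) := by
    intro i
    by_cases hi : i ∈ Finset.Icc 1 M
    · obtain ⟨v, hv⟩ := exists_quot (a := μ + 1) hm hgcd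
        (lamK_add (s := s) hμ hρ1 hρμ hm hkl i) (by split_ifs <;> simp) (by
          push_cast
          exact hrank i hi)
      exact ⟨v, fun _ => by simpa only [Nat.cast_add, Nat.cast_one] using hv⟩
    · exact ⟨0, fun h => absurd h hi⟩
  choose y hy using hex
  have hval : ∀ i ∈ Finset.Icc 1 M, i ≠ p → β i = m * y i := fun i hi hne => by
    simpa [hne] using (hy i hi).1
  have hpmem : p ∈ Finset.Icc 1 M := Finset.mem_Icc.mpr ⟨by omega, hpM⟩
  have hcrit : CritPair μ s l ρ m k M (Lam1 μ s l ρ 1) y β :=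
    { μ_pos := hμ
      ρ_pos := hρ1
      ρ_le := hρμ
      m_pos := hm
      k_lt := hkl
      L_lt := hL ▸ hLM
      pos := fun i => exists_Lam1_add_eq hμ hρμ
      zero := fun i => Lam1_of_lt
      val := hval
      val_p := by simpa using (hy p hpmem).1
      rank_eq := fun i hi hne => by
        have hr := (hy i hi).2
        rwa [if_neg hne, Nat.cast_zero, sub_zero] at hr
      rank_p := by
        have hr := (hy p hpmem).2
        rwa [if_pos rfl, Nat.cast_one] at hr
      dom := fun T hT => by
        rw [← psum_lamK_add hμ hρ1 hρμ hm hkl]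
        exact Nat.add_le_add_right (sum_le_psum_of_trigeq
          (fun i j hi hij _ => lamK_antitone hμ hρ1 hρμ hm hkl hi hij) hdom hT) _
      sum_eq := by
        rw [← psum_lamK_add hμ hρ1 hρμ hm hkl, if_pos hpM, psum_eq_of_trigeq hdom, psum]
      next := by
        have h1 := hval (L + 1) (Finset.mem_Icc.mpr ⟨by omega, hLM⟩) (by omega)
        rw [hβL, hL] at h1
        exact (Nat.eq_of_mul_eq_mul_left hm (by rw [mul_one]; exact h1)).symm }
  have hlam : ∀ i, i ≠ p → lamK μ s l ρ m k i = m * Lam1 μ s l ρ 1 i := fun i hi => by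
    simpa [hi, ← hp] using lamK_add (s := s) hμ hρ1 hρμ hm hkl i
  refine ⟨fun i hi1 hip => ?_, fun i hi hil => ?_⟩
  · have himem : i ∈ Finset.Icc 1 M := Finset.mem_Icc.mpr ⟨hi1, by omega⟩
    rw [hlam i hip.ne, hval i himem hip.ne, hcrit.y_eq_forcedQuot himem, forcedQuot, if_pos hip]
  · have hsup : lenOf M β ≤ M ∧ lenOf M β ≤ p + μ + (μ + 1) * (s + l - k) := by
      rw [← le_min_iff]
      refine Finset.sup_le fun j hj => le_min ?_ ?_
      · exact (Finset.mem_Icc.mp (Finset.mem_filter.mp hj).1).2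
      · obtain ⟨hjM, hj0⟩ := Finset.mem_filter.mp hj
        by_contra! hlt
        simp only [id_eq] at hlt
        refine hj0 ?_
        rw [hval j hjM (by omega), hcrit.y_eq_forcedQuot hjM, forcedQuot, ← hp,
          if_neg (by omega), if_neg (by omega), if_neg (by omega), mul_zero]
    rw [add_mul, one_mul] at hi
    have himem : i ∈ Finset.Icc 1 M := Finset.mem_Icc.mpr ⟨by omega, hil.trans hsup.1⟩
    rw [hlam i (by omega), hval i himem (by omega), hcrit.y_eq_forcedQuot himem, forcedQuot, ← hp,
      if_neg (by omega), if_neg (by omega), if_pos (hil.trans hsup.2), mul_add, mul_one]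
end
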